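/- arXiv:2209.01787 — 2 statements merged into one kernel-verified Lean document; each statement's English description precedes it below -/
import Mathlib

section
/- Let a₀ = 1 and, for n ≥ 1, let aₙ be half the number of subsets S of the 3×2n board with |S| = 3n such that both S and its complement are connected (i.e., the number of dissections of the 3×2n board into two connected polyominoes of area 3n each). Then for every real x with |x| < 1/64, the series ∑_{n=0}^∞ aₙ xⁿ converges, and its sum equals (1 + √(1−4x)) / ((√(1−4x) + x)² · √(1−4x)) − (1 − x² + 2x³)/(1−x)³. -/
/-- The grid graph on the `m × n` board: two cells are adjacent when they agree
in one coordinate and differ by exactly 1 in the other. -/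
def gridGraph (m n : ℕ) : SimpleGraph (Fin m × Fin n) :=
  SimpleGraph.fromRel (fun a b =>
    (a.1 = b.1 ∧ (a.2 : ℕ) + 1 = (b.2 : ℕ)) ∨ (a.2 = b.2 ∧ (a.1 : ℕ) + 1 = (b.1 : ℕ)))

/-- A subset of cells is connected if the induced subgraph of the grid graph is
connected (in particular nonempty). -/
def ConnectedRegion (m n : ℕ) (S : Finset (Fin m × Fin n)) : Prop :=
  ((gridGraph m n).induce (S : Set (Fin m × Fin n))).Connected

namespace Gerry

/-! ### The two-colour column automaton -/

inductive St
  | start | dead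
  | A (b : Bool) | D (b : Bool) | Sp (b : Bool) | Cc (b : Bool)
  | M (t m : Bool)
  deriving DecidableEq, Fintype

abbrev Col := Bool × Bool × Bool

def del : St → Col → St
  | .start, (a, b, c) => if a = c then (if a = b then .A a else .Sp a) else .M a b
  | .dead, _ => .dead
  | .A b', (a, b, c) =>
      if a = c then
        (if a = b then (if a = b' then .A a else .D a) else (if a = b' then .Cc a else .Sp a))
      else .M a b
  | .D b', (a, b, c) => if a = b' ∧ b = b' ∧ c = b' then .D b' else .dead
  | .Sp b', (a, b, c) => if a = b' ∧ c = b' then (if b = b' then .D b' else .Sp b') else .dead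
  | .Cc b', (a, b, c) =>
      if a = c then (if a = b then .D a else (if a = b' then .Cc a else .dead))
      else (if b = b' then .dead else .M a b)
  | .M t m, (a, b, c) =>
      if a = c then (if a = b then .D a else (if b = m then .Sp a else .dead))
      else (if a = t then .M a b else .dead)

def acc : St → Bool
  | .D _ => true
  | .Cc _ => true
  | .M _ _ => true
  | _ => false

def bw (b : Bool) : ℤ := if b then 1 else -1

def wt (c : Col) : ℤ := bw c.1 + bw c.2.1 + bw c.2.2

/-- number of completions of length `k` from state `s` with current excess `d` -/
def g : ℕ → St → ℤ → ℕ
  | 0, s, d => if acc s = true ∧ d = 0 then 1 else 0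
  | k + 1, s, d => ∑ c : Col, g k (del s c) (d + wt c)

lemma g_le (k : ℕ) : ∀ s d, g k s d ≤ 8 ^ k := by
  induction k with
  | zero => intro s d; simp only [g]; split_ifs <;> simp
  | succ k ih =>
    intro s d
    calc g (k + 1) s d = ∑ c : Col, g k (del s c) (d + wt c) := rfl
      _ ≤ ∑ c : Col, 8 ^ k := Finset.sum_le_sum (fun c _ => ih _ _)
      _ = 8 ^ (k + 1) := by simp [pow_succ, mul_comm]

/-! ### Basic functions -/

def Ind (d : ℤ) : ℂ := if d = 0 then 1 else 0
def fD (z : ℂ) (d : ℤ) : ℂ := if d ≤ 0 ∧ (3 : ℤ) ∣ d then z ^ ((-d) / 3).toNat else 0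
def fQ (z : ℂ) (d : ℤ) : ℂ := if d ≤ 0 then z ^ (-d).toNat else 0
def fK (u : ℂ) (d : ℤ) : ℂ := u ^ d.natAbs

lemma fD_rec (z : ℂ) (d : ℤ) : fD z d = Ind d + z * fD z (d + 3) := by
  unfold fD Ind
  by_cases h3 : (3 : ℤ) ∣ d
  · obtain ⟨e, rfl⟩ := h3
    rcases lt_trichotomy e 0 with h | h | h
    · rw [if_pos ⟨by omega, by simp⟩, if_neg (by omega), if_pos ⟨by omega, by omega⟩, zero_add,
        ← pow_succ']
      congr 1; omega
    · subst h; simp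
    · rw [if_neg (by omega), if_neg (by omega), if_neg (by omega)]; simp
  · rw [if_neg (by tauto), if_neg (by omega), if_neg (by omega)]; simp

lemma fD_pos (z : ℂ) (d : ℤ) (h : 0 < d) : fD z d = 0 := by
  unfold fD; rw [if_neg (by omega)]

lemma fD_ndvd (z : ℂ) (d : ℤ) (h : ¬ (3 : ℤ) ∣ d) : fD z d = 0 := by
  unfold fD; rw [if_neg (by tauto)]

lemma fQ_rec (z : ℂ) (d : ℤ) : fQ z d = Ind d + z * fQ z (d + 1) := by
  unfold fQ Ind
  rcases lt_trichotomy d 0 with h | h | h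
  · rw [if_pos (by omega), if_neg (by omega), if_pos (by omega), zero_add, ← pow_succ']
    congr 1; omega
  · subst h; simp
  · rw [if_neg (by omega), if_neg (by omega), if_neg (by omega)]; simp

lemma fQ_pos (z : ℂ) (d : ℤ) (h : 0 < d) : fQ z d = 0 := by
  unfold fQ; rw [if_neg (by omega)]

lemma fK_rec (z u : ℂ) (hu : u = z * (1 + u ^ 2)) (d : ℤ) :
    fK u d = z * (fK u (d + 1) + fK u (d - 1)) + (1 - 2 * z * u) * Ind d := by
  unfold fK Ind
  rcases lt_trichotomy d 0 with h | h | h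
  · obtain ⟨n, rfl⟩ : ∃ n : ℕ, d = -((n : ℤ) + 1) := ⟨(-d - 1).toNat, by omega⟩
    rw [show (-((n : ℤ) + 1)).natAbs = n + 1 by omega,
      show (-((n : ℤ) + 1) + 1).natAbs = n by omega,
      show (-((n : ℤ) + 1) - 1).natAbs = n + 2 by omega, if_neg (by omega)]
    linear_combination u ^ n * hu
  · subst h; simp; ring
  · obtain ⟨n, rfl⟩ : ∃ n : ℕ, d = ((n : ℤ) + 1) := ⟨(d - 1).toNat, by omega⟩
    rw [show (((n : ℤ) + 1)).natAbs = n + 1 by omega,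
      show (((n : ℤ) + 1) + 1).natAbs = n + 2 by omega,
      show (((n : ℤ) + 1) - 1).natAbs = n by omega, if_neg (by omega)]
    linear_combination u ^ n * hu

lemma fK_neg (u : ℂ) (d : ℤ) : fK u (-d) = fK u d := by simp [fK]
lemma Ind_neg (d : ℤ) : Ind (-d) = Ind d := by simp [Ind]
lemma Ind_ne (d : ℤ) (h : d ≠ 0) : Ind d = 0 := by simp [Ind, h]

lemma Ind_bd (d : ℤ) : ‖Ind d‖ ≤ 1 := by unfold Ind; split_ifs <;> simp
lemma fD_bd (z : ℂ) (hz : ‖z‖ ≤ 1) (d : ℤ) : ‖fD z d‖ ≤ 1 := by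
  unfold fD; split_ifs
  · rw [norm_pow]; exact pow_le_one₀ (norm_nonneg _) hz
  · simp
lemma fQ_bd (z : ℂ) (hz : ‖z‖ ≤ 1) (d : ℤ) : ‖fQ z d‖ ≤ 1 := by
  unfold fQ; split_ifs
  · rw [norm_pow]; exact pow_le_one₀ (norm_nonneg _) hz
  · simp
lemma fK_bd (u : ℂ) (hu : ‖u‖ ≤ 1) (d : ℤ) : ‖fK u d‖ ≤ 1 := by
  unfold fK; rw [norm_pow]; exact pow_le_one₀ (norm_nonneg _) hu

/-! ### The explicit potential -/

structure Par where
  (z u κ l0 l1 l2 μ c0 c1 c2 α β : ℂ)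
  hz : ‖z‖ ≤ 1
  hu1 : ‖u‖ ≤ 1
  hu : u = z * (1 + u ^ 2)
  hμ : μ * (1 - z ^ 2) = 1
  h0 : l0 - l2 - z * l1 = μ
  h1 : l1 - z * l0 - z * l2 = z ^ 3 * μ
  h2 : l2 - z * l1 - z ^ 2 * l0 = z ^ 4 * μ
  hκ : κ * (1 - 2 * z * u) = l0 - μ - 2 * l2 - 1
  hc0 : c0 - z * c1 = 1 + 2 * l2
  hc1 : c1 - z * c2 = 2 * z * l0
  hc2 : c2 - z ^ 2 * c0 = 2 * z * l1
  hα : α * (1 - z * u ^ 3) = 2 * κ + 2 * z * u * κ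
  hβ : β * (1 - z ^ 2) = 2 * z * l1 + 2 * l2 + z * c1 + 3 * z ^ 2 * μ + 1

namespace Par
variable (p : Par)

def V (d : ℤ) : ℂ := p.κ * fK p.u d + p.l0 * (fD p.z d + fD p.z (-d))
  + p.l1 * (fD p.z (d + 1) + fD p.z (-d + 1)) + p.l2 * (fD p.z (d + 2) + fD p.z (-d + 2))
  + p.μ * (fQ p.z d + fQ p.z (-d)) - (p.l0 + p.μ) * Ind d

def sp (d : ℤ) : ℂ := p.μ * (fD p.z d + p.z * fD p.z (d + 1) + p.z ^ 2 * fD p.z (d + 2) - fQ p.z d)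

def P (d : ℤ) : ℂ := p.V d + p.z * p.sp (1 - d)

def C (d : ℤ) : ℂ := 2 * p.κ * fK p.u d + p.c0 * fD p.z (-d) + p.c1 * fD p.z (-d + 1)
  + p.c2 * fD p.z (-d + 2) + 2 * p.μ ^ 2 * fQ p.z (-d)

def A (d : ℤ) : ℂ := p.α * fK p.u d + p.β * fD p.z (-d) + p.μ ^ 3 * fQ p.z (-d)

lemma V_neg (d : ℤ) : p.V (-d) = p.V d := by
  unfold V; rw [fK_neg, Ind_neg, neg_neg]; ring

lemma sp_rec (d : ℤ) : p.sp d = p.z * (p.sp (d + 1) + fD p.z (d + 3)) := by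
  have e1 := fD_rec p.z d
  have e2 := fQ_rec p.z d
  unfold sp
  rw [show d + 1 + 1 = d + 2 by ring, show d + 1 + 2 = d + 3 by ring]
  linear_combination p.μ * e1 - p.μ * e2 + p.z * fD p.z (d + 3) * p.hμ

lemma V_rec (d : ℤ) : p.V d = p.z * (p.V (d + 1) + p.V (d - 1)) + p.z ^ 2 * (p.sp d + p.sp (-d))
    + fD p.z d + fD p.z (-d) - Ind d := by
  have eK := fK_rec p.z p.u p.hu d
  have a1 := fD_rec p.z d
  have a2 := fD_rec p.z (d - 1)
  have b1 := fD_rec p.z (-d)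
  have b2 := fD_rec p.z (-d - 1)
  have q1 := fQ_rec p.z d
  have q2 := fQ_rec p.z (d - 1)
  have r1 := fQ_rec p.z (-d)
  have r2 := fQ_rec p.z (-d - 1)
  have i1 := Ind_neg d
  have i2 : Ind (-d - 1) = Ind (d + 1) := by rw [← Ind_neg]; congr 1; ring
  unfold V sp
  rw [show d + 1 + 1 = d + 2 by ring, show d + 1 + 2 = d + 3 by ring,
    show d - 1 + 1 = d by ring, show d - 1 + 2 = d + 1 by ring,
    show -(d + 1) = -d - 1 by ring, show -d - 1 + 1 = -d by ring, show -d - 1 + 2 = -d + 1 by ring,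
    show -(d - 1) = -d + 1 by ring, show -d + 1 + 1 = -d + 2 by ring,
    show -d + 1 + 2 = -d + 3 by ring]
  rw [show d - 1 + 3 = d + 2 by ring] at a2
  rw [show d - 1 + 1 = d by ring] at q2
  rw [show -d - 1 + 3 = -d + 2 by ring] at b2
  rw [show -d - 1 + 1 = -d by ring] at r2
  rw [i1] at b1 r1
  rw [i2] at b2 r2
  rw [a2, b2, q2, r2]
  linear_combination p.κ * eK + p.l2 * a1 + p.l2 * b1 + p.μ * q1 + p.μ * r1 + Ind d * p.hκ
    + (fD p.z d + fD p.z (-d)) * (p.h0 + p.hμ)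
    + (fD p.z (d + 1) + fD p.z (-d + 1)) * p.h1
    + (fD p.z (d + 2) + fD p.z (-d + 2)) * p.h2

lemma P_rec (d : ℤ) : p.P d = Ind d + p.z * (p.P (d + 1) + p.P (-(d - 1)) + fD p.z (d + 3)
    + fD p.z (-(d - 3)) + p.sp (-(d - 1))) := by
  have e1 := p.V_rec d
  have e2 := fD_rec p.z d
  have e3 := fD_rec p.z (-d)
  have e4 := p.V_neg (d - 1)
  unfold P
  rw [show 1 - (d + 1) = -d by ring, show 1 - -(d - 1) = d by ring, show -(d - 3) = -d + 3 by ring,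
    show 1 - d = -(d - 1) by ring, e4]
  rw [Ind_neg] at e3
  linear_combination e1 + e2 + e3

lemma sp_pos (d : ℤ) (hd : 0 < d) : p.sp d = 0 := by
  unfold sp
  rw [fD_pos _ _ hd, fD_pos _ (d + 1) (by omega), fD_pos _ (d + 2) (by omega), fQ_pos _ _ hd]; ring

lemma V_nonneg (d : ℤ) (hd : 0 ≤ d) : p.V d = p.κ * fK p.u d + p.l0 * fD p.z (-d)
    + p.l1 * fD p.z (-d + 1) + p.l2 * fD p.z (-d + 2) + p.μ * fQ p.z (-d) := by
  unfold V
  rcases hd.eq_or_lt with h | h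
  · subst h
    simp [fD, fQ, Ind]
    ring
  · rw [fD_pos _ _ h, fD_pos _ (d + 1) (by omega), fD_pos _ (d + 2) (by omega), fQ_pos _ _ h,
      Ind_ne _ (by omega)]; ring

lemma C_rec (d : ℤ) (hd : 0 < d) : p.C d = p.z * (p.C (d + 1) + fD p.z (d + 3)
    + fD p.z (-(d - 3)) + 2 * p.P (-(d - 1))) := by
  have eK := fK_rec p.z p.u p.hu d
  rw [Ind_ne d (by omega)] at eK
  have hP : p.P (-(d - 1)) = p.V (d - 1) := by
    unfold P; rw [V_neg, show 1 - -(d - 1) = d by ring, sp_pos _ _ hd]; ring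
  rw [hP, V_nonneg _ _ (by omega : 0 ≤ d - 1), fD_pos _ (d + 3) (by omega)]
  unfold C
  have a0 := fD_rec p.z (-d)
  have a1 := fD_rec p.z (-d - 1)
  have q0 := fQ_rec p.z (-d)
  have q1 := fQ_rec p.z (-d - 1)
  rw [Ind_ne _ (by omega)] at a0 a1 q0 q1
  rw [show -d - 1 + 3 = -d + 2 by ring] at a1
  rw [show -d - 1 + 1 = -d by ring] at q1
  rw [show -(d - 3) = -d + 3 by ring, show -(d - 1) = -d + 1 by ring, show -d + 1 + 1 = -d + 2 by ring,
    show -d + 1 + 2 = -d + 3 by ring, show -(d + 1) = -d - 1 by ring,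
    show -d - 1 + 1 = -d by ring, show -d - 1 + 2 = -d + 1 by ring, a1, q1]
  linear_combination 2 * p.κ * eK + (1 + 2 * p.l2) * a0 + 2 * p.μ * q0
    + fD p.z (-d) * p.hc0 + fD p.z (-d + 1) * p.hc1 + fD p.z (-d + 2) * p.hc2
    + 2 * p.μ * fQ p.z (-d) * p.hμ

lemma A_rec (d : ℤ) (hd : 0 < d) (h3 : (3 : ℤ) ∣ d) :
    p.A d = p.z * (p.A (d + 3) + 2 * p.P (d + 1) + 2 * p.P (-(d - 1)) + p.C (d + 1)
      + p.sp (-(d - 1)) + fD p.z (-(d - 3))) := by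
  have eK := fK_rec p.z p.u p.hu d
  rw [Ind_ne d (by omega)] at eK
  have hK3 : fK p.u (d + 3) = p.u ^ 3 * fK p.u d := by
    unfold fK; rw [← pow_add]; congr 1; omega
  have hK1 : fK p.u (d + 1) = p.u * fK p.u d := by
    unfold fK; rw [← pow_succ']; congr 1; omega
  have hP : p.P (-(d - 1)) = p.V (d - 1) := by
    unfold P; rw [V_neg, show 1 - -(d - 1) = d by ring, sp_pos _ _ hd]; ring
  have hP' : p.P (d + 1) = p.V (d + 1) + p.z * p.sp (-d) := by
    unfold P; rw [show 1 - (d + 1) = -d by ring]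
  rw [hP, hP', V_nonneg _ _ (by omega : 0 ≤ d - 1), V_nonneg _ _ (by omega : 0 ≤ d + 1)]
  unfold C A sp
  have a0 := fD_rec p.z (-d)
  have a3 := fD_rec p.z (-d - 3)
  have q0 := fQ_rec p.z (-d)
  have q1 := fQ_rec p.z (-d - 1)
  have q2 := fQ_rec p.z (-d - 2)
  have q3 := fQ_rec p.z (-d - 3)
  rw [Ind_ne _ (by omega)] at a0 a3 q0 q1 q2 q3
  rw [show -d - 3 + 3 = -d by ring] at a3
  rw [show -d - 1 + 1 = -d by ring] at q1
  rw [show -d - 2 + 1 = -d - 1 by ring, q1] at q2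
  rw [show -d - 3 + 1 = -d - 2 by ring, q2] at q3
  rw [show -(d - 3) = -d + 3 by ring, show -(d - 1) = -d + 1 by ring, show -d + 1 + 1 = -d + 2 by ring,
    show -d + 1 + 2 = -d + 3 by ring, show -(d + 1) = -d - 1 by ring, show -(d + 3) = -d - 3 by ring,
    show -d - 1 + 1 = -d by ring, show -d - 1 + 2 = -d + 1 by ring, q1, q3, a3,
    fD_ndvd _ (-d - 1) (by omega), fD_ndvd _ (-d + 1) (by omega), fD_ndvd _ (-d + 2) (by omega),
    hK3]
  rw [hK1] at eK ⊢
  linear_combination 2 * p.κ * eK + fK p.u d * p.hα + fD p.z (-d) * p.hβ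
    + (1 + 2 * p.l2 + p.z ^ 2 * p.μ) * a0 + p.μ * q0
    + fQ p.z (-d) * ((p.μ ^ 2 + p.z ^ 2 * p.μ ^ 2) * p.hμ + p.μ * p.hμ)

/-! ### The potential as a function on states -/

def sg (b : Bool) (d : ℤ) : ℤ := if b then d else -d

def phi : St → ℤ → ℂ
  | .start, _ => 2 * p.z * (p.A 3 + 2 * p.P 1)
  | .dead, _ => 0
  | .A b, d => p.A (sg b d)
  | .D b, d => fD p.z (sg b d)
  | .Sp b, d => p.sp (sg b d)
  | .Cc b, d => p.C (sg b d)
  | .M _ m, d => p.P (sg m d)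

def Good : St → ℤ → Prop
  | .start, d => d = 0
  | .A b, d => 0 < sg b d ∧ (3 : ℤ) ∣ d
  | .Cc b, d => 0 < sg b d
  | _, _ => True

lemma good_del (s : St) (c : Col) (d : ℤ) (h : Good s d) : Good (del s c) (d + wt c) := by
  obtain ⟨a, b, e⟩ := c
  rcases s with _ | _ | t | t | t | t | ⟨t, m⟩
  · simp only [Good] at h
    subst h
    cases a <;> cases b <;> cases e <;> simp [Good, del, wt, bw, sg]
  all_goals
    revert h
  all_goals try cases t
  all_goals try cases m
  all_goals
    cases a <;> cases b <;> cases e <;> simp only [Good, del, wt, bw, sg] <;> simp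
  all_goals omega

lemma phi_rec (s : St) (d : ℤ) (h : Good s d) :
    p.phi s d = (if acc s = true ∧ d = 0 then 1 else 0)
      + p.z * ∑ c : Col, p.phi (del s c) (d + wt c) := by
  have h3 : (1 : ℤ) + (1 + 1) = 3 := by norm_num
  rcases s with _ | _ | t | t | t | t | ⟨t, m⟩
  · simp only [Good] at h
    subst h
    simp [Fintype.sum_prod_type, del, acc, phi, wt, bw, sg, sp_pos]
    ring
  · simp [del, acc, phi]
  · cases t
    · have := p.A_rec (-d) (by simpa [Good, sg] using h.1) (by simpa using h.2)
      simp [Fintype.sum_prod_type, del, acc, phi, wt, bw, sg]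
      rw [this]
      ring_nf
    · have := p.A_rec d (by simpa [Good, sg] using h.1) (by simpa using h.2)
      simp [Fintype.sum_prod_type, del, acc, phi, wt, bw, sg]
      rw [this]
      ring_nf
  · cases t
    · have := fD_rec p.z (-d)
      simp [Fintype.sum_prod_type, del, acc, phi, wt, bw, sg, Ind] at this ⊢
      rw [this]
      ring_nf
    · have := fD_rec p.z d
      simp [Fintype.sum_prod_type, del, acc, phi, wt, bw, sg, Ind] at this ⊢
      rw [this]
  · cases t
    · have := p.sp_rec (-d)
      simp [Fintype.sum_prod_type, del, acc, phi, wt, bw, sg] at this ⊢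
      rw [this]
      ring_nf
    · have := p.sp_rec d
      simp [Fintype.sum_prod_type, del, acc, phi, wt, bw, sg, Ind] at this ⊢
      rw [this]
      ring_nf
  · cases t
    · have h' : 0 < -d := by simpa [Good, sg] using h
      have := p.C_rec (-d) h'
      have hd : d ≠ 0 := by omega
      simp [Fintype.sum_prod_type, del, acc, phi, wt, bw, sg, hd]
      rw [this]
      ring_nf
    · have h' : 0 < d := by simpa [Good, sg] using h
      have := p.C_rec d h'
      have hd : d ≠ 0 := by omega
      simp [Fintype.sum_prod_type, del, acc, phi, wt, bw, sg, hd]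
      rw [this]
      ring_nf
  · cases m
    · have := p.P_rec (-d)
      rw [Ind_neg] at this
      cases t <;>
      · simp [Fintype.sum_prod_type, del, acc, phi, wt, bw, sg]
        rw [this, Ind]
        ring_nf
    · have := p.P_rec d
      cases t <;>
      · simp [Fintype.sum_prod_type, del, acc, phi, wt, bw, sg]
        rw [this, Ind]
        ring_nf

lemma phi_bd : ∃ B : ℝ, ∀ s d, ‖p.phi s d‖ ≤ B := by
  have hD := fD_bd p.z p.hz
  have hQ := fQ_bd p.z p.hz
  have hK := fK_bd p.u p.hu1
  have key : ∀ (a f : ℂ), ‖f‖ ≤ 1 → ‖a * f‖ ≤ ‖a‖ := by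
    intro a f hf
    rw [norm_mul]
    exact mul_le_of_le_one_right (norm_nonneg _) hf
  have key2 : ∀ (a f : ℂ) (b : ℝ), ‖f‖ ≤ b → ‖a * f‖ ≤ ‖a‖ * b := by
    intro a f b hf
    rw [norm_mul]
    exact mul_le_mul_of_nonneg_left hf (norm_nonneg _)
  have hsp : ∃ B : ℝ, ∀ d, ‖p.sp d‖ ≤ B := by
    refine ⟨‖p.μ‖ * (1 + ‖p.z‖ + ‖p.z ^ 2‖ + 1), fun d => ?_⟩
    unfold sp
    refine key2 _ _ _ ((norm_sub_le _ _).trans (add_le_add ?_ (hQ _)))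
    exact norm_add₃_le.trans (add_le_add_three (hD _) (key _ _ (hD _)) (key _ _ (hD _)))
  have hV : ∃ B : ℝ, ∀ d, ‖p.V d‖ ≤ B := by
    refine ⟨‖p.κ‖ + ‖p.l0‖ * (1 + 1) + ‖p.l1‖ * (1 + 1) + ‖p.l2‖ * (1 + 1) + ‖p.μ‖ * (1 + 1)
      + ‖p.l0 + p.μ‖, fun d => ?_⟩
    unfold V
    refine (norm_sub_le _ _).trans (add_le_add ?_ (key _ _ (Ind_bd _)))
    refine (norm_add_le _ _).trans (add_le_add ?_
      (key2 _ _ _ ((norm_add_le _ _).trans (add_le_add (hQ _) (hQ _)))))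
    refine (norm_add_le _ _).trans (add_le_add ?_
      (key2 _ _ _ ((norm_add_le _ _).trans (add_le_add (hD _) (hD _)))))
    refine (norm_add_le _ _).trans (add_le_add ?_
      (key2 _ _ _ ((norm_add_le _ _).trans (add_le_add (hD _) (hD _)))))
    exact (norm_add_le _ _).trans (add_le_add (key _ _ (hK _))
      (key2 _ _ _ ((norm_add_le _ _).trans (add_le_add (hD _) (hD _)))))
  obtain ⟨B1, h1⟩ := hsp
  obtain ⟨B2, h2⟩ := hV
  have hP : ∀ d, ‖p.P d‖ ≤ B2 + ‖p.z‖ * B1 := fun d =>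
    (norm_add_le _ _).trans (add_le_add (h2 _) (key2 _ _ _ (h1 _)))
  have hC : ∃ B : ℝ, ∀ d, ‖p.C d‖ ≤ B := by
    refine ⟨‖2 * p.κ‖ + ‖p.c0‖ + ‖p.c1‖ + ‖p.c2‖ + ‖2 * p.μ ^ 2‖, fun d => ?_⟩
    unfold C
    refine (norm_add_le _ _).trans (add_le_add ?_ (key _ _ (hQ _)))
    refine (norm_add_le _ _).trans (add_le_add ?_ (key _ _ (hD _)))
    refine (norm_add_le _ _).trans (add_le_add ?_ (key _ _ (hD _)))
    exact (norm_add_le _ _).trans (add_le_add (key _ _ (hK _)) (key _ _ (hD _)))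
  have hA : ∃ B : ℝ, ∀ d, ‖p.A d‖ ≤ B := by
    refine ⟨‖p.α‖ + ‖p.β‖ + ‖p.μ ^ 3‖, fun d => ?_⟩
    unfold A
    refine (norm_add_le _ _).trans (add_le_add ?_ (key _ _ (hQ _)))
    exact (norm_add_le _ _).trans (add_le_add (key _ _ (hK _)) (key _ _ (hD _)))
  obtain ⟨B3, h3⟩ := hC
  obtain ⟨B4, h4⟩ := hA
  refine ⟨max (‖2 * p.z * (p.A 3 + 2 * p.P 1)‖) (max 1 (max B1 (max (B2 + ‖p.z‖ * B1)
    (max B3 B4)))), fun s d => ?_⟩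
  rcases s with _ | _ | t | t | t | t | ⟨t, m⟩ <;> simp only [phi, le_max_iff]
  · left; exact le_rfl
  · right; left; simp
  · exact Or.inr (Or.inr (Or.inr (Or.inr (Or.inr (h4 _)))))
  · exact Or.inr (Or.inl (hD _))
  · exact Or.inr (Or.inr (Or.inl (h1 _)))
  · exact Or.inr (Or.inr (Or.inr (Or.inr (Or.inl (h3 _)))))
  · exact Or.inr (Or.inr (Or.inr (Or.inl (hP _))))

lemma phi_approx (B : ℝ) (hB : ∀ s d, ‖p.phi s d‖ ≤ B) (k : ℕ) : ∀ s d, Good s d →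
    ‖p.phi s d - ∑ i ∈ Finset.range k, (g i s d : ℂ) * p.z ^ i‖ ≤ B * (8 * ‖p.z‖) ^ k := by
  induction k with
  | zero => intro s d _; simpa using hB s d
  | succ k ih =>
    intro s d h
    rw [p.phi_rec s d h, Finset.sum_range_succ']
    have e : ∑ i ∈ Finset.range k, (g (i + 1) s d : ℂ) * p.z ^ (i + 1)
        = p.z * ∑ c : Col, ∑ i ∈ Finset.range k, (g i (del s c) (d + wt c) : ℂ) * p.z ^ i := by
      rw [Finset.sum_comm, Finset.mul_sum]
      refine Finset.sum_congr rfl fun i _ => ?_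
      rw [show g (i + 1) s d = ∑ c : Col, g i (del s c) (d + wt c) from rfl, ← Finset.sum_mul]
      push_cast
      ring
    have e0 : (g 0 s d : ℂ) = if acc s = true ∧ d = 0 then 1 else 0 := by
      simp only [g]; split_ifs <;> simp
    rw [e, e0, pow_zero, mul_one]
    rw [show ∀ a b c : ℂ, a + b - (c + a) = b - c by intros; ring, ← mul_sub,
      ← Finset.sum_sub_distrib, norm_mul]
    calc _ ≤ ‖p.z‖ * ∑ c : Col, B * (8 * ‖p.z‖) ^ k := by
          gcongr
          exact norm_sum_le_of_le _ fun c _ => ih _ _ (good_del s c d h)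
      _ = B * (8 * ‖p.z‖) ^ (k + 1) := by
          simp; ring

lemma hasSum_g (hz8 : ‖p.z‖ < 1 / 8) :
    HasSum (fun k => (g k .start 0 : ℂ) * p.z ^ k) (2 * p.z * (p.A 3 + 2 * p.P 1)) := by
  have h8 : 8 * ‖p.z‖ < 1 := by linarith
  have h0 : 0 ≤ 8 * ‖p.z‖ := by positivity
  have hs : Summable (fun k => (g k .start 0 : ℂ) * p.z ^ k) := by
    refine Summable.of_norm_bounded (summable_geometric_of_lt_one h0 h8) fun k => ?_
    rw [norm_mul, norm_pow, mul_pow, Complex.norm_natCast]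
    gcongr
    exact_mod_cast g_le k _ _
  obtain ⟨B, hB⟩ := p.phi_bd
  have ht := hs.hasSum.tendsto_sum_nat
  have ht2 : Filter.Tendsto (fun k => ∑ i ∈ Finset.range k, (g i .start 0 : ℂ) * p.z ^ i)
      Filter.atTop (nhds (p.phi .start 0)) := by
    rw [tendsto_iff_norm_sub_tendsto_zero]
    have hl : Filter.Tendsto (fun k : ℕ => B * (8 * ‖p.z‖) ^ k) Filter.atTop (nhds 0) := by
      simpa using (tendsto_pow_atTop_nhds_zero_of_lt_one h0 h8).const_mul B
    refine squeeze_zero (fun _ => norm_nonneg _) (fun k => ?_) hl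
    rw [norm_sub_rev]
    exact p.phi_approx B hB k _ _ rfl
  have := tendsto_nhds_unique ht ht2
  have h2 := hs.hasSum
  rw [this] at h2
  exact h2

end Par
/-! ### Explicit parameters and evaluation -/

lemma exists_par (x : ℝ) (hx : |x| < 1 / 64) :
    ∃ p : Par, p.z ^ 2 = (x : ℂ) ∧ ‖p.z‖ < 1 / 8 ∧
      2 * p.z * (p.A 3 + 2 * p.P 1) = 2 * ((((1 + Real.sqrt (1 - 4 * x)) /
          ((Real.sqrt (1 - 4 * x) + x) ^ 2 * Real.sqrt (1 - 4 * x))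
        - (1 - x ^ 2 + 2 * x ^ 3) / (1 - x) ^ 3 : ℝ) : ℂ) - 1) := by
  obtain ⟨z, hz⟩ : ∃ z : ℂ, z ^ 2 = (x : ℂ) := IsAlgClosed.exists_pow_nat_eq _ (by norm_num)
  rw [abs_lt] at hx
  set s := Real.sqrt (1 - 4 * x) with hs
  have hs2 : s ^ 2 = 1 - 4 * x := Real.sq_sqrt (by linarith)
  have hs0 : 0 ≤ s := Real.sqrt_nonneg _
  have hs1 : 1 / 2 < s := by nlinarith
  have hxs : x = (1 - s ^ 2) / 4 := by linarith
  have hzn : ‖z‖ < 1 / 8 := by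
    have h1 : ‖z‖ ^ 2 = |x| := by rw [← norm_pow, hz, Complex.norm_real, Real.norm_eq_abs]
    have h2 : |x| < 1 / 64 := abs_lt.2 hx
    nlinarith [norm_nonneg z]
  have r1 : 1 + s ≠ 0 := by linarith
  have r2 : s ≠ 0 := by linarith
  have r3 : 1 - x ≠ 0 := by linarith
  have r4 : 1 - x ^ 2 ≠ 0 := by nlinarith
  have r5 : s + x ≠ 0 := by linarith
  have r6 : s - x ≠ 0 := by linarith
  have r7 : 2 * (1 + s) - (1 - s) ^ 2 ≠ 0 := by nlinarith
  have c1 : (1 + s : ℂ) ≠ 0 := by exact_mod_cast r1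
  have c2 : (s : ℂ) ≠ 0 := by exact_mod_cast r2
  have c3 : (1 - x : ℂ) ≠ 0 := by exact_mod_cast r3
  have c4 : (1 - x ^ 2 : ℂ) ≠ 0 := by exact_mod_cast r4
  have c5 : (s + x : ℂ) ≠ 0 := by exact_mod_cast r5
  have c6 : (s - x : ℂ) ≠ 0 := by exact_mod_cast r6
  have c7 : (2 * (1 + s) - (1 - s) ^ 2 : ℂ) ≠ 0 := by exact_mod_cast r7
  have cs : (s : ℂ) ^ 2 = 1 - 4 * x := by exact_mod_cast hs2
  obtain ⟨C, hC⟩ : ∃ C : ℂ, C = 2 / (1 + s) := ⟨_, rfl⟩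
  have hCn : ‖C‖ < 2 := by
    have : C = ((2 / (1 + s) : ℝ) : ℂ) := by rw [hC]; push_cast; rfl
    rw [this, Complex.norm_real, Real.norm_eq_abs, abs_of_nonneg (by positivity),
      div_lt_iff₀ (by linarith)]
    linarith
  have hCx : C = 1 + x * C ^ 2 := by
    rw [hC]; field_simp; linear_combination (-1 : ℂ) * cs
  have hxC : (x : ℂ) * C = (1 - s) / 2 := by
    rw [hC]; field_simp; linear_combination (1 : ℂ) * cs
  have hxC3 : (x : ℂ) ^ 2 * C ^ 3 = (1 - s) ^ 2 / (2 * (1 + s)) := by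
    rw [show (x : ℂ) ^ 2 * C ^ 3 = (x * C) ^ 2 * C by ring, hxC, hC]
    field_simp
  obtain ⟨E, hE⟩ : ∃ E : ℂ, E = (s - x) * (s + x) := ⟨_, rfl⟩
  have hE0 : E ≠ 0 := by rw [hE]; exact mul_ne_zero c6 c5
  have hE' : E = 1 - 4 * x - x ^ 2 := by rw [hE]; linear_combination cs
  obtain ⟨μ, hμ⟩ : ∃ μ : ℂ, μ = 1 / (1 - x) := ⟨_, rfl⟩
  obtain ⟨l0, hl0⟩ : ∃ l0 : ℂ, l0 = (1 - x + 3 * x ^ 2 + x ^ 3) / E / (1 - x) := ⟨_, rfl⟩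
  obtain ⟨l2, hl2⟩ : ∃ l2 : ℂ, l2 = 2 * x * (1 + x) / E / (1 - x) := ⟨_, rfl⟩
  obtain ⟨m, hm⟩ : ∃ m : ℂ, m = x * μ + l0 + l2 := ⟨_, rfl⟩
  obtain ⟨κ, hκ⟩ : ∃ κ : ℂ, κ = (3 * x - 1) / (E * s) := ⟨_, rfl⟩
  obtain ⟨c0, hc0⟩ : ∃ c0 : ℂ, c0 = (1 + 2 * l2 + 2 * x * l0 + 2 * x * x * m) / (1 - x ^ 2) := ⟨_, rfl⟩
  obtain ⟨e2, he2⟩ : ∃ e2 : ℂ, e2 = x * c0 + 2 * x * m := ⟨_, rfl⟩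
  obtain ⟨e1, he1⟩ : ∃ e1 : ℂ, e1 = e2 + 2 * l0 := ⟨_, rfl⟩
  obtain ⟨α, hα⟩ : ∃ α : ℂ, α = (2 * κ + 2 * (x * C) * κ) / (1 - x ^ 2 * C ^ 3) := ⟨_, rfl⟩
  obtain ⟨β, hβ⟩ : ∃ β : ℂ, β = (2 * x * m + 2 * l2 + x * e1 + 3 * x * μ + 1) / (1 - x) := ⟨_, rfl⟩
  have c8 : (1 - (x : ℂ) ^ 2 * C ^ 3) ≠ 0 := by
    rw [hxC3]
    intro h
    apply c7
    field_simp at h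
    linear_combination h
  let p : Par :=
    { z := z, u := z * C, κ := κ, l0 := l0, l1 := z * m, l2 := l2, μ := μ, c0 := c0, c1 := z * e1,
      c2 := e2, α := α, β := β
      hz := by linarith
      hu1 := by rw [norm_mul]; nlinarith [norm_nonneg z, norm_nonneg C]
      hu := by linear_combination z * hCx - z * C ^ 2 * hz
      hμ := by rw [hz, hμ]; field_simp
      h0 := by
        rw [show z * (z * m) = z ^ 2 * m by ring, hz, hm, hl0, hl2, hμ]
        field_simp
        rw [hE']; ring
      h1 := by rw [hm]; linear_combination - z * μ * hz
      h2 := by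
        rw [show z ^ 4 = (z ^ 2) ^ 2 by ring, show z * (z * m) = z ^ 2 * m by ring, hz, hm, hl0,
          hl2, hμ]
        field_simp
        rw [hE']; ring
      hκ := by
        rw [show 1 - 2 * z * (z * C) = s by linear_combination -2 * hxC - 2 * C * hz, hκ, hl0, hl2,
          hμ]
        field_simp
        rw [hE']; ring
      hc0 := by
        rw [show z * (z * e1) = z ^ 2 * e1 by ring, hz, he1, he2, hc0]
        field_simp
        ring
      hc1 := by rw [he1]; ring
      hc2 := by rw [he2]; linear_combination (2 * m - c0) * hz - 4 * m * hz
      hα := by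
        rw [show 1 - z * (z * C) ^ 3 = 1 - (z ^ 2) ^ 2 * C ^ 3 by ring,
          show 2 * z * (z * C) * κ = 2 * (z ^ 2 * C) * κ by ring, hz, hα]
        field_simp
      hβ := by
        rw [show 2 * z * (z * m) = 2 * z ^ 2 * m by ring, show z * (z * e1) = z ^ 2 * e1 by ring,
          hz, hβ]
        field_simp }
  refine ⟨p, hz, hzn, ?_⟩
  have hA : 2 * p.z * (p.A 3 + 2 * p.P 1) = 2 * (α * (x ^ 2 * C ^ 3) + β * x + μ ^ 3 * x ^ 2
      + 2 * κ * (x * C) + 2 * x * m + 2 * μ * x) := by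
    unfold Par.A Par.P Par.V Par.sp
    simp [fD, fQ, fK, Ind, p]
    rw [← hz]; ring
  rw [hA]
  clear hA
  clear p
  have m' : m = (1 + x) ^ 2 / (E * (1 - x)) := by
    rw [hm, hl0, hl2, hμ]; field_simp; rw [hE']; ring
  have c0' : c0 = (1 + 7 * x ^ 2 + 4 * x ^ 3) / (E * (1 - x) ^ 2) := by
    rw [hc0, m', hl0, hl2, div_eq_div_iff c4 (by positivity)]; field_simp; rw [hE']; ring
  have e1' : e1 = (2 - x + 10 * x ^ 2 + x ^ 3) / (E * (1 - x) ^ 2) := by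
    rw [he1, he2, c0', m', hl0]; field_simp; ring
  have β' : β = (1 + 5 * x - 6 * x ^ 2 + 11 * x ^ 3 + x ^ 4) / (E * (1 - x) ^ 3) := by
    rw [hβ, e1', m', hl2, hμ]; field_simp; rw [hE']; ring
  have R' : β * x + μ ^ 3 * x ^ 2 + 2 * x * m + 2 * μ * x =
      (5 * x - 6 * x ^ 2 + 2 * x ^ 3 + 6 * x ^ 4 + x ^ 5) / (E * (1 - x) ^ 3) := by
    rw [β', m', hμ]; field_simp; rw [hE']; ring
  have hxs' : (x : ℂ) = (1 - (s : ℂ) ^ 2) / 4 := by exact_mod_cast hxs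
  have S' : α * (x ^ 2 * C ^ 3) + 2 * κ * (x * C) =
      κ * ((3 - s) * (1 - s) ^ 2 / (4 * (s + x)) + (1 - s)) := by
    rw [hα]
    rw [hxC3] at c8
    rw [hxC, hxC3, hxs']
    rw [hxs'] at c5
    have : (1 + 4 * (s : ℂ) - s ^ 2) ≠ 0 := by
      intro h; apply c5; linear_combination h / 4
    rw [show 1 - (1 - (s : ℂ)) ^ 2 / (2 * (1 + s)) = (1 + 4 * s - s ^ 2) / (2 * (1 + s)) by
      field_simp; ring,
      show 4 * ((s : ℂ) + (1 - s ^ 2) / 4) = 1 + 4 * s - s ^ 2 by ring]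
    field_simp
    ring
  have T' : α * (x ^ 2 * C ^ 3) + β * x + μ ^ 3 * x ^ 2
      + 2 * κ * (x * C) + 2 * x * m + 2 * μ * x =
      κ * ((3 - s) * (1 - s) ^ 2 / (4 * (s + x)) + (1 - s)) +
      (5 * x - 6 * x ^ 2 + 2 * x ^ 3 + 6 * x ^ 4 + x ^ 5) / (E * (1 - x) ^ 3) := by
    rw [← S', ← R']; ring
  rw [T', hκ, hE]
  push_cast
  rw [hxs'] at c3 c5 c6 ⊢
  have d3 : (3 + (s : ℂ) ^ 2) ≠ 0 := by
    intro h; apply c3; linear_combination h / 4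
  have d5 : (1 + 4 * (s : ℂ) - s ^ 2) ≠ 0 := by
    intro h; apply c5; linear_combination h / 4
  have d6 : (s ^ 2 + 4 * (s : ℂ) - 1) ≠ 0 := by
    intro h; apply c6; linear_combination h / 4
  rw [show (1 : ℂ) - (1 - (s : ℂ) ^ 2) / 4 = (3 + s ^ 2) / 4 by ring,
    show (s : ℂ) + (1 - s ^ 2) / 4 = (1 + 4 * s - s ^ 2) / 4 by ring,
    show (s : ℂ) - (1 - s ^ 2) / 4 = (s ^ 2 + 4 * s - 1) / 4 by ring]
  clear R' S' T' β' e1' c0' m' hβ hα he1 he2 hc0 hκ hm hl2 hl0 hμ hE' hE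
  generalize hf : (1 + 4 * (s : ℂ) - s ^ 2) = f at *
  generalize hh : ((s : ℂ) ^ 2 + 4 * s - 1) = h at *
  generalize hk : (3 + (s : ℂ) ^ 2) = k at *
  field_simp
  rw [← hf, ← hh, ← hk]
  ring
/-! ### One-colour connectivity automaton -/

abbrev Cell := Fin 3 × ℕ

def adj (p q : Cell) : Prop :=
  (p.1 = q.1 ∧ (p.2 + 1 = q.2 ∨ q.2 + 1 = p.2)) ∨
    (p.2 = q.2 ∧ ((p.1 : ℕ) + 1 = q.1 ∨ (q.1 : ℕ) + 1 = p.1))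

lemma adj_symm {p q : Cell} (h : adj p q) : adj q p := by
  unfold adj at *
  rcases h with ⟨h1, h2⟩ | ⟨h1, h2⟩
  · exact Or.inl ⟨h1.symm, h2.symm⟩
  · exact Or.inr ⟨h1.symm, h2.symm⟩

def In (S : ℕ → Fin 3 → Bool) (k : ℕ) (p : Cell) : Prop := p.2 < k ∧ S p.2 p.1 = true

def Stp (S : ℕ → Fin 3 → Bool) (k : ℕ) (p q : Cell) : Prop := adj p q ∧ In S k p ∧ In S k q

def R (S : ℕ → Fin 3 → Bool) (k : ℕ) : Cell → Cell → Prop := Relation.ReflTransGen (Stp S k)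

def Full (S : ℕ → Fin 3 → Bool) (k : ℕ) : Prop := ∀ p q, In S k p → In S k q → R S k p q

lemma In_mono {S k K} (h : k ≤ K) {p} (hp : In S k p) : In S K p := ⟨hp.1.trans_le h, hp.2⟩

lemma R_mono {S k K} (h : k ≤ K) {p q} (hp : R S k p q) : R S K p q := by
  unfold R at *
  induction hp with
  | refl => exact .refl
  | tail _ h2 ih => exact ih.tail ⟨h2.1, In_mono h h2.2.1, In_mono h h2.2.2⟩

lemma R_symm {S k p q} (h : R S k p q) : R S k q p := by
  unfold R at *
  induction h with
  | refl => exact .refl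
  | tail _ h2 ih => exact ih.head ⟨adj_symm h2.1, h2.2.2, h2.2.1⟩

lemma R_trans {S k p q r} (h : R S k p q) (h' : R S k q r) : R S k p r :=
  Relation.ReflTransGen.trans h h'

lemma Full_hub {S k} (h : Cell) (hh : ∀ p, In S k p → R S k p h) : Full S k :=
  fun p q hp hq => R_trans (hh p hp) (R_symm (hh q hq))

lemma R_closed {S k} (A : Cell → Prop)
    (hA : ∀ p q, A p → Stp S k p q → A q) {p q} (h : R S k p q) (hp : A p) : A q := by
  unfold R at h
  induction h with
  | refl => exact hp
  | tail _ h2 ih => exact hA _ _ ih h2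

/-- A separated set kills connectivity for ever. -/
lemma dead_of {S : ℕ → Fin 3 → Bool} {k} (A : Cell → Prop)
    (hA : ∀ p q, A p → adj p q → S q.2 q.1 = true → A q)
    {p q} (hp : A p) (hq : ¬ A q) (ip : In S k p) (iq : In S k q) :
    ∀ K, k ≤ K → ¬ Full S K := by
  intro K hK hF
  exact hq (R_closed A (fun p q h1 h2 => hA p q h1 h2.1 h2.2.2.2)
    (hF p q (In_mono hK ip) (In_mono hK iq)) hp)

inductive Ph
  | E | C | S | F | X
  deriving DecidableEq

def stp : Ph → Col → Col → Ph
  | .E, _, T => if T = (false, false, false) then .E else if T = (true, false, true) then .S else .C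
  | .C, (u0, u1, u2), (t0, t1, t2) =>
      if (t0, t1, t2) = (false, false, false) then .F
      else if (u0 && t0) = false ∧ (u1 && t1) = false ∧ (u2 && t2) = false then .X
      else if (t0, t1, t2) = (true, false, true) ∧ (u0 && u2) = false then .S
      else .C
  | .F, _, T => if T = (false, false, false) then .F else .X
  | .S, _, T => if T = (true, false, true) then .S else if T = (true, true, true) then .C else .X
  | .X, _, _ => .X

def pcol (S : ℕ → Fin 3 → Bool) (j : ℕ) : Col := (S j 0, S j 1, S j 2)

def ph (S : ℕ → Fin 3 → Bool) : ℕ → Ph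
  | 0 => .E
  | k + 1 => stp (ph S k) (pcol S (k - 1)) (pcol S k)

def Inv (S : ℕ → Fin 3 → Bool) (k : ℕ) : Ph → Prop
  | .E => ∀ p, ¬ In S k p
  | .C => Full S k ∧ 0 < k ∧ pcol S (k - 1) ≠ (false, false, false)
  | .F => Full S k ∧ 0 < k ∧ pcol S (k - 1) = (false, false, false) ∧ ∃ p, In S k p
  | .S => 0 < k ∧ pcol S (k - 1) = (true, false, true) ∧
      (∀ p, In S k p → R S k p (0, k - 1) ∨ R S k p (2, k - 1)) ∧ ¬ R S k (0, k - 1) (2, k - 1)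
  | .X => ∀ K, k ≤ K → ¬ Full S K

lemma In_succ {S k} {p : Cell} (h : In S (k + 1) p) : In S k p ∨ (p = (p.1, k) ∧ S k p.1 = true) := by
  obtain ⟨i, j⟩ := p
  obtain ⟨h1, h2⟩ := h
  simp only at h1 h2 ⊢
  rcases (Nat.lt_succ_iff.1 h1).lt_or_eq with h | h
  · exact Or.inl ⟨h, h2⟩
  · subst h; exact Or.inr ⟨rfl, h2⟩

lemma R_v01 {S k} (h0 : S k 0 = true) (h1 : S k 1 = true) : R S (k + 1) (0, k) (1, k) :=
  Relation.ReflTransGen.single ⟨Or.inr ⟨rfl, by simp⟩, ⟨by simp, h0⟩, ⟨by simp, h1⟩⟩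

lemma R_v12 {S k} (h0 : S k 1 = true) (h1 : S k 2 = true) : R S (k + 1) (1, k) (2, k) :=
  Relation.ReflTransGen.single ⟨Or.inr ⟨rfl, by simp⟩, ⟨by simp, h0⟩, ⟨by simp, h1⟩⟩

lemma R_h {S k} (i : Fin 3) (h0 : S k i = true) (h1 : S (k + 1) i = true) :
    R S (k + 2) (i, k + 1) (i, k) :=
  Relation.ReflTransGen.single ⟨Or.inl ⟨rfl, by simp⟩, ⟨by simp, h1⟩, ⟨by simp, h0⟩⟩

lemma fin3 (i : Fin 3) : i = 0 ∨ i = 1 ∨ i = 2 := by omega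

/-- neighbours of a cell in column `k`, to the left or in the same column -/
lemma adj_top {k : ℕ} {i : Fin 3} {q : Cell} (h : adj (i, k) q) (hq : q.2 < k + 1) :
    (q.1 = i ∧ q.2 + 1 = k) ∨ (q.2 = k ∧ (i = 1 ∨ q.1 = 1)) := by
  obtain ⟨a, b⟩ := q
  simp only [adj] at h hq ⊢
  rcases h with ⟨h1, h2⟩ | ⟨h1, h2⟩
  · exact Or.inl ⟨h1.symm, by omega⟩
  · refine Or.inr ⟨h1.symm, ?_⟩
    omega

lemma adj_old {k : ℕ} {p q : Cell} (h : adj p q) (hp : p.2 < k + 1) (hq : ¬ q.2 < k + 1) :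
    p = (q.1, k) ∧ q = (q.1, k + 1) := by
  obtain ⟨a, b⟩ := q
  obtain ⟨c, d⟩ := p
  simp only [adj] at h hp hq ⊢
  simp only [Prod.mk.injEq, true_and]
  rcases h with ⟨h1, h2⟩ | ⟨h1, h2⟩
  · exact ⟨⟨h1, by omega⟩, by omega⟩
  · omega

lemma inv_succ_E (S : ℕ → Fin 3 → Bool) (k : ℕ) (U : Col) (h : Inv S k .E) :
    Inv S (k + 1) (stp .E U (pcol S k)) := by
  simp only [Inv] at h
  have hnew : ∀ p, In S (k + 1) p → p = (p.1, k) ∧ S k p.1 = true := fun p hp =>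
    (In_succ hp).resolve_left (h p)
  by_cases hT : pcol S k = (false, false, false)
  · have e : stp .E U (pcol S k) = .E := by rw [hT]; rfl
    rw [e]
    intro p hp
    obtain ⟨_, h2⟩ := hnew p hp
    simp only [pcol, Prod.mk.injEq] at hT
    rcases fin3 p.1 with h | h | h <;> rw [h] at h2
    · rw [hT.1] at h2; simp at h2
    · rw [hT.2.1] at h2; simp at h2
    · rw [hT.2.2] at h2; simp at h2
  by_cases hT2 : pcol S k = (true, false, true)
  · have e : stp .E U (pcol S k) = .S := by rw [hT2]; rfl
    rw [e]
    have hT3 := hT2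
    simp only [pcol, Prod.mk.injEq] at hT3
    refine ⟨by omega, hT2, ?_, ?_⟩
    · intro p hp
      obtain ⟨h1, h2⟩ := hnew p hp
      rw [h1, Nat.add_sub_cancel]
      rcases fin3 p.1 with h | h | h
      · rw [h]; exact Or.inl Relation.ReflTransGen.refl
      · rw [h] at h2; simp_all
      · rw [h]; exact Or.inr Relation.ReflTransGen.refl
    · rw [Nat.add_sub_cancel]
      intro hR
      have := R_closed (fun p => p = (0, k)) ?_ hR rfl
      · simp at this
      · rintro p q rfl ⟨h1, h2, h3⟩
        obtain ⟨e1, e2⟩ := hnew q h3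
        rcases fin3 q.1 with h | h | h
        · rw [e1, h]
        · rw [h] at e2; simp_all
        · rcases adj_top h1 h3.1 with h' | h'
          · rw [e1] at h'; simp at h'
          · rw [h] at h'; simp at h'
  · have e : stp .E U (pcol S k) = .C := by simp [stp, hT, hT2]
    rw [e]
    refine ⟨?_, by omega, hT⟩
    simp only [pcol, Prod.mk.injEq] at hT hT2
    have key : ∀ a b, S k a = true → S k b = true → R S (k + 1) (a, k) (b, k) := by
      have hmid : S k 0 = true → S k 2 = true → S k 1 = true := by
        intro a b; by_contra c; simp_all
      have h01 := @R_v01 S k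
      have h12 := @R_v12 S k
      intro a b ha hb
      rcases fin3 a with rfl | rfl | rfl <;> rcases fin3 b with rfl | rfl | rfl
      · exact Relation.ReflTransGen.refl
      · exact h01 ha hb
      · exact R_trans (h01 ha (hmid ha hb)) (h12 (hmid ha hb) hb)
      · exact R_symm (h01 hb ha)
      · exact Relation.ReflTransGen.refl
      · exact h12 ha hb
      · exact R_symm (R_trans (h01 hb (hmid hb ha)) (h12 (hmid hb ha) ha))
      · exact R_symm (h12 hb ha)
      · exact Relation.ReflTransGen.refl
    intro p q hp hq
    obtain ⟨h1, h2⟩ := hnew p hp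
    obtain ⟨h3, h4⟩ := hnew q hq
    rw [h1, h3]
    exact key _ _ h2 h4

lemma inv_succ_F (S : ℕ → Fin 3 → Bool) (k : ℕ) (h : Inv S (k + 1) .F) :
    Inv S (k + 2) (stp .F (pcol S k) (pcol S (k + 1))) := by
  obtain ⟨h1, -, h2, ⟨p0, h3⟩⟩ := h
  rw [Nat.add_sub_cancel] at h2
  simp only [pcol, Prod.mk.injEq] at h2
  have hcol : ∀ i, S k i = false := by
    intro i; rcases fin3 i with rfl | rfl | rfl <;> simp_all
  by_cases hT : pcol S (k + 1) = (false, false, false)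
  · have e : stp .F (pcol S k) (pcol S (k + 1)) = .F := by rw [hT]; rfl
    rw [e]
    refine ⟨?_, by omega, hT, p0, In_mono (by omega) h3⟩
    have hcol' : ∀ i, S (k + 1) i = false := by
      simp only [pcol, Prod.mk.injEq] at hT
      intro i; rcases fin3 i with rfl | rfl | rfl <;> simp_all
    have : ∀ p, In S (k + 2) p → In S (k + 1) p := fun p hp =>
      (In_succ hp).resolve_right (fun h => by rw [hcol'] at h; simp at h)
    exact fun p q hp hq => R_mono (by omega) (h1 p q (this p hp) (this q hq))
  · have e : stp .F (pcol S k) (pcol S (k + 1)) = .X := by simp [stp, hT]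
    rw [e]
    obtain ⟨i, hi⟩ : ∃ i, S (k + 1) i = true := by
      by_contra hc
      push Not at hc
      apply hT
      simp [pcol, hc]
    refine dead_of (fun p => In S (k + 1) p) ?_ h3 (q := (i, k + 1)) (fun h => by
      have := h.1; simp at this) (In_mono (by omega) h3) ⟨by simp, hi⟩
    intro p q hp hpq hq
    refine ⟨?_, hq⟩
    by_contra hc
    obtain ⟨e1, e2⟩ := adj_old hpq hp.1 hc
    have := hp.2
    rw [e1, hcol] at this
    simp at this

lemma decS0 : ∀ U T : Col, stp .C U T = .C →
    T.1 = true → U.1 = true ∨ (T.2.1 = true ∧ U.2.1 = true) ∨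
      (T.2.1 = true ∧ T.2.2 = true ∧ U.2.2 = true) := by decide
lemma decS1 : ∀ U T : Col, stp .C U T = .C →
    T.2.1 = true → U.2.1 = true ∨ (T.1 = true ∧ U.1 = true) ∨
      (T.2.2 = true ∧ U.2.2 = true) := by decide
lemma decS2 : ∀ U T : Col, stp .C U T = .C →
    T.2.2 = true → U.2.2 = true ∨ (T.2.1 = true ∧ U.2.1 = true) ∨
      (T.2.1 = true ∧ T.1 = true ∧ U.1 = true) := by decide
lemma decCC : ∀ U T : Col, stp .C U T = .C → T ≠ (false, false, false) := by decide
lemma decCF : ∀ U T : Col, stp .C U T = .F → T = (false, false, false) := by decide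
lemma decCX : ∀ U T : Col, stp .C U T = .X → T ≠ (false, false, false) ∧
    (U.1 = true → T.1 = false) ∧ (U.2.1 = true → T.2.1 = false) ∧
    (U.2.2 = true → T.2.2 = false) := by decide
lemma decCS : ∀ U T : Col, stp .C U T = .S → T = (true, false, true) ∧
    ((U.1 = true ∧ U.2.2 = false) ∨ (U.1 = false ∧ U.2.2 = true)) := by decide
lemma decCE : ∀ U T : Col, stp .C U T ≠ .E := by decide

lemma exists_of_pcol {S : ℕ → Fin 3 → Bool} {k} (h : pcol S k ≠ (false, false, false)) :
    ∃ i, S k i = true := by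
  by_contra hc
  push Not at hc
  apply h
  simp [pcol, hc]

lemma inv_succ_C (S : ℕ → Fin 3 → Bool) (k : ℕ) (h : Inv S (k + 1) .C) :
    Inv S (k + 2) (stp .C (pcol S k) (pcol S (k + 1))) := by
  obtain ⟨h1, -, h2⟩ := h
  rw [Nat.add_sub_cancel] at h2
  obtain ⟨i0, hi0⟩ := exists_of_pcol h2
  have hold : ∀ p, In S (k + 1) p → R S (k + 2) p (i0, k) := fun p hp =>
    R_mono (by omega) (h1 p _ hp ⟨by simp, hi0⟩)
  have holdc : ∀ i, S k i = true → R S (k + 2) (i, k) (i0, k) := fun i hi =>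
    hold _ ⟨by simp, hi⟩
  rcases e : stp .C (pcol S k) (pcol S (k + 1)) with _ | _ | _ | _ | _
  · exact absurd e (decCE _ _)
  · have d0 := decS0 _ _ e
    have d1 := decS1 _ _ e
    have d2 := decS2 _ _ e
    simp only [pcol] at d0 d1 d2
    refine ⟨Full_hub (i0, k) ?_, by omega, decCC _ _ e⟩
    have hh := @R_h S k
    have h01 := @R_v01 S (k + 1)
    have h12 := @R_v12 S (k + 1)
    have att : ∀ i, S k i = true → S (k + 1) i = true → R S (k + 2) (i, k + 1) (i0, k) :=
      fun i a b => R_trans (hh i a b) (holdc i a)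
    intro p hp
    rcases In_succ hp with hp | ⟨hp, hp'⟩
    · exact hold p hp
    rw [hp]
    rcases fin3 p.1 with h | h | h <;> rw [h] at hp' ⊢
    · rcases d0 hp' with a | ⟨a, b⟩ | ⟨a, b, c⟩
      · exact att 0 a hp'
      · exact R_trans (h01 hp' a) (att 1 b a)
      · exact R_trans (h01 hp' a) (R_trans (h12 a b) (att 2 c b))
    · rcases d1 hp' with a | ⟨a, b⟩ | ⟨a, b⟩
      · exact att 1 a hp'
      · exact R_trans (R_symm (h01 a hp')) (att 0 b a)
      · exact R_trans (h12 hp' a) (att 2 b a)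
    · rcases d2 hp' with a | ⟨a, b⟩ | ⟨a, b, c⟩
      · exact att 2 a hp'
      · exact R_trans (R_symm (h12 a hp')) (att 1 b a)
      · exact R_trans (R_symm (h12 a hp')) (R_trans (R_symm (h01 b a)) (att 0 c b))
  · obtain ⟨hT, hU⟩ := decCS _ _ e
    have hT' := hT
    simp only [pcol, Prod.mk.injEq] at hT' hU
    obtain ⟨t0, t1, t2⟩ := hT'
    have nconn : ∀ i j : Fin 3, i ≠ 1 → i ≠ j → S k i = false → S (k + 1) i = true →
        ¬ R S (k + 2) (i, k + 1) (j, k + 1) := by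
      intro i j hi1 hij hi hi' hR
      have := R_closed (fun p => p = (i, k + 1)) ?_ hR rfl
      · simp at this; exact hij this.symm
      · rintro p q rfl ⟨a, b, c⟩
        rcases adj_top a c.1 with ⟨x, y⟩ | ⟨x, y⟩
        · have := c.2
          rw [x, show q.2 = k by omega, hi] at this
          simp at this
        · have := c.2
          rw [x, y.resolve_left hi1, t1] at this
          simp at this
    refine ⟨by omega, hT, ?_, ?_⟩
    · intro p hp
      simp only [show k + 2 - 1 = k + 1 by omega]
      rcases hU with ⟨u0, u2⟩ | ⟨u0, u2⟩
      · have hb := R_symm (R_trans (R_h 0 u0 t0) (holdc 0 u0))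
        rcases In_succ hp with hp | ⟨hp, hp'⟩
        · exact Or.inl (R_trans (hold p hp) hb)
        · rw [hp]
          rcases fin3 p.1 with h | h | h <;> rw [h] at hp' ⊢
          · exact Or.inl Relation.ReflTransGen.refl
          · rw [t1] at hp'; simp at hp'
          · exact Or.inr Relation.ReflTransGen.refl
      · have hb := R_symm (R_trans (R_h 2 u2 t2) (holdc 2 u2))
        rcases In_succ hp with hp | ⟨hp, hp'⟩
        · exact Or.inr (R_trans (hold p hp) hb)
        · rw [hp]
          rcases fin3 p.1 with h | h | h <;> rw [h] at hp' ⊢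
          · exact Or.inl Relation.ReflTransGen.refl
          · rw [t1] at hp'; simp at hp'
          · exact Or.inr Relation.ReflTransGen.refl
    · simp only [show k + 2 - 1 = k + 1 by omega]
      rcases hU with ⟨u0, u2⟩ | ⟨u0, u2⟩
      · intro hR
        exact nconn 2 0 (by simp) (by simp) u2 t2 (R_symm hR)
      · exact nconn 0 2 (by simp) (by simp) u0 t0
  · have hT := decCF _ _ e
    refine ⟨?_, by omega, hT, (i0, k), ⟨by simp, hi0⟩⟩
    refine Full_hub (i0, k) fun p hp => ?_
    rcases In_succ hp with hp | ⟨hp, hp'⟩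
    · exact hold p hp
    · simp only [pcol, Prod.mk.injEq] at hT
      rcases fin3 p.1 with h | h | h <;> rw [h] at hp'
      · rw [hT.1] at hp'; simp at hp'
      · rw [hT.2.1] at hp'; simp at hp'
      · rw [hT.2.2] at hp'; simp at hp'
  · obtain ⟨hT, d0, d1, d2⟩ := decCX _ _ e
    obtain ⟨i, hi⟩ := exists_of_pcol hT
    simp only [pcol] at d0 d1 d2
    have hd : ∀ j, S k j = true → S (k + 1) j = false := by
      intro j; rcases fin3 j with rfl | rfl | rfl <;> assumption
    refine dead_of (fun p => In S (k + 1) p) ?_ (p := (i0, k)) ⟨by simp, hi0⟩ (q := (i, k + 1))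
      (fun h => by have := h.1; simp at this) ⟨by simp, hi0⟩ ⟨by simp, hi⟩
    intro p q hp hpq hq
    refine ⟨?_, hq⟩
    by_contra hc
    obtain ⟨e1, e2⟩ := adj_old hpq hp.1 hc
    have := hp.2
    rw [e1] at this
    have h3 := hd _ this
    rw [e2] at hq
    simp only at hq h3
    rw [h3] at hq
    simp at hq

lemma inv_succ_S (S : ℕ → Fin 3 → Bool) (k : ℕ) (h : Inv S (k + 1) .S) :
    Inv S (k + 2) (stp .S (pcol S k) (pcol S (k + 1))) := by
  obtain ⟨-, h1, h2, h3⟩ := h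
  rw [Nat.add_sub_cancel] at h1 h2 h3
  simp only [pcol, Prod.mk.injEq] at h1
  obtain ⟨u0, u1, u2⟩ := h1
  -- classes of the two ends
  have hcl : ∀ i j : Fin 3, i ≠ j → i ≠ 1 → j ≠ 1 → ¬ R S (k + 1) (i, k) (j, k) := by
    intro i j hij hi hj
    rcases fin3 i with rfl | rfl | rfl <;> rcases fin3 j with rfl | rfl | rfl <;>
      first
      | exact absurd rfl hij
      | exact absurd rfl hi
      | exact absurd rfl hj
      | exact h3
      | exact fun h => h3 (R_symm h)
  by_cases hT : pcol S (k + 1) = (true, false, true)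
  · have e : stp .S (pcol S k) (pcol S (k + 1)) = .S := by rw [hT]; rfl
    rw [e]
    have hT' := hT
    simp only [pcol, Prod.mk.injEq] at hT'
    obtain ⟨t0, t1, t2⟩ := hT'
    refine ⟨by omega, hT, ?_, ?_⟩
    · intro p hp
      simp only [show k + 2 - 1 = k + 1 by omega]
      rcases In_succ hp with hp | ⟨hp, hp'⟩
      · rcases h2 p hp with h | h
        · exact Or.inl (R_trans (R_mono (by omega) h) (R_symm (R_h 0 u0 t0)))
        · exact Or.inr (R_trans (R_mono (by omega) h) (R_symm (R_h 2 u2 t2)))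
      · rw [hp]
        rcases fin3 p.1 with h | h | h <;> rw [h] at hp' ⊢
        · exact Or.inl Relation.ReflTransGen.refl
        · rw [t1] at hp'; simp at hp'
        · exact Or.inr Relation.ReflTransGen.refl
    · simp only [show k + 2 - 1 = k + 1 by omega]
      intro hR
      have := R_closed (fun p => (In S (k + 1) p ∧ R S (k + 1) (0, k) p) ∨ p = (0, k + 1)) ?_ hR
        (Or.inr rfl)
      · rcases this with h | h
        · have := h.1.1; simp at this
        · simp at h
      · rintro p q hp ⟨a, b, c⟩
        rcases hp with ⟨hp, hp'⟩ | rfl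
        · by_cases hq : q.2 < k + 1
          · exact Or.inl ⟨⟨hq, c.2⟩, hp'.tail ⟨a, hp, ⟨hq, c.2⟩⟩⟩
          · obtain ⟨e1, e2⟩ := adj_old a hp.1 hq
            rcases fin3 q.1 with h | h | h
            · right; rw [e2, h]
            · have := hp.2; rw [e1, h, u1] at this; simp at this
            · rw [e1, h] at hp'; exact absurd hp' h3
        · rcases adj_top a c.1 with ⟨x, y⟩ | ⟨x, y⟩
          · left
            have : q = (0, k) := Prod.ext x (by omega)
            rw [this]
            exact ⟨⟨by simp, u0⟩, Relation.ReflTransGen.refl⟩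
          · have := c.2
            rw [x, y.resolve_left (by simp), t1] at this
            simp at this
  by_cases hT2 : pcol S (k + 1) = (true, true, true)
  · have e : stp .S (pcol S k) (pcol S (k + 1)) = .C := by rw [hT2]; rfl
    rw [e]
    have hT' := hT2
    simp only [pcol, Prod.mk.injEq] at hT'
    obtain ⟨t0, t1, t2⟩ := hT'
    refine ⟨Full_hub (1, k + 1) fun p hp => ?_, by omega, by
      rw [show k + 2 - 1 = k + 1 by omega, hT2]; simp⟩
    rcases In_succ hp with hp | ⟨hp, hp'⟩
    · rcases h2 p hp with h | h
      · exact R_trans (R_mono (by omega) h) (R_trans (R_symm (R_h 0 u0 t0)) (R_v01 t0 t1))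
      · exact R_trans (R_mono (by omega) h) (R_trans (R_symm (R_h 2 u2 t2)) (R_symm (R_v12 t1 t2)))
    · rw [hp]
      rcases fin3 p.1 with h | h | h <;> rw [h]
      · exact R_v01 t0 t1
      · exact Relation.ReflTransGen.refl
      · exact R_symm (R_v12 t1 t2)
  · have e : stp .S (pcol S k) (pcol S (k + 1)) = .X := by simp [stp, hT, hT2]
    rw [e]
    have kill : ∀ i j : Fin 3, i ≠ 1 → j ≠ 1 → i ≠ j → S k i = true → S k j = true →
        S (k + 1) i = false → Inv S (k + 2) .X := by
      intro i j hi hj hij hSi hSj hSi'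
      refine dead_of (fun p => In S (k + 1) p ∧ R S (k + 1) (i, k) p) ?_ (p := (i, k))
        ⟨⟨by simp, hSi⟩, Relation.ReflTransGen.refl⟩ (q := (j, k))
        (fun h => hcl i j hij hi hj h.2) ⟨by simp, hSi⟩ ⟨by simp, hSj⟩
      rintro p q ⟨hp, hp'⟩ a c
      by_cases hq : q.2 < k + 1
      · exact ⟨⟨hq, c⟩, hp'.tail ⟨a, hp, ⟨hq, c⟩⟩⟩
      · exfalso
        obtain ⟨e1, e2⟩ := adj_old a hp.1 hq
        by_cases hqi : q.1 = i
        · rw [e2, hqi, hSi'] at c; simp at c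
        · by_cases hq1 : q.1 = 1
          · have := hp.2; rw [e1, hq1, u1] at this; simp at this
          · rw [e1] at hp'
            exact hcl i q.1 (Ne.symm hqi) hi hq1 hp'
    rcases h0 : S (k + 1) 0 with _ | _
    · exact kill 0 2 (by simp) (by simp) (by simp) u0 u2 h0
    rcases h2 : S (k + 1) 2 with _ | _
    · exact kill 2 0 (by simp) (by simp) (by simp) u2 u0 h2
    exfalso
    rcases h1 : S (k + 1) 1 with _ | _
    · exact hT (by simp [pcol, h0, h1, h2])
    · exact hT2 (by simp [pcol, h0, h1, h2])

lemma inv_ph (S : ℕ → Fin 3 → Bool) (k : ℕ) : Inv S k (ph S k) := by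
  induction k with
  | zero => intro p hp; exact absurd hp.1 (by omega)
  | succ k ih =>
    rw [ph]
    cases k with
    | zero => exact inv_succ_E S 0 _ ih
    | succ k =>
      rw [Nat.add_sub_cancel]
      rcases e : ph S (k + 1) with _ | _ | _ | _ | _ <;> rw [e] at ih
      · exact inv_succ_E S _ _ ih
      · exact inv_succ_C S _ ih
      · exact inv_succ_S S _ ih
      · exact inv_succ_F S _ ih
      · exact fun K hK => ih K (by omega)

lemma ph_iff (S : ℕ → Fin 3 → Bool) (k : ℕ) :
    (Full S k ∧ ∃ p, In S k p) ↔ (ph S k = .C ∨ ph S k = .F) := by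
  have h := inv_ph S k
  rcases e : ph S k with _ | _ | _ | _ | _ <;> rw [e] at h <;> simp
  · exact fun _ i j => h (i, j)
  · obtain ⟨h1, h2, h3⟩ := h
    obtain ⟨i, hi⟩ := exists_of_pcol h3
    exact ⟨h1, i, k - 1, by simp; omega, hi⟩
  · intro hF
    obtain ⟨h0, h1, h2, h3⟩ := h
    simp only [pcol, Prod.mk.injEq] at h1
    exact absurd (hF _ _ ⟨by simp; omega, h1.1⟩ ⟨by simp; omega, h1.2.2⟩) h3
  · obtain ⟨h1, h2, h3, ⟨i, j⟩, h4⟩ := h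
    exact ⟨h1, i, j, h4⟩
  · intro hF
    exact absurd hF (h k le_rfl)

/-! ### Linking the two automata -/

def ph1 : St → Ph
  | .start => .E
  | .dead => .X
  | .A b => if b then .C else .E
  | .D b => if b then .C else .F
  | .Sp b => if b then .S else .C
  | .Cc _ => .C
  | .M _ _ => .C

def ph2 : St → Ph
  | .start => .E
  | .dead => .X
  | .A b => if b then .E else .C
  | .D b => if b then .F else .C
  | .Sp b => if b then .C else .S
  | .Cc _ => .C
  | .M _ _ => .C

def last : St → Col
  | .start => (false, false, false)
  | .dead => (false, false, false)
  | .A b => (b, b, b)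
  | .D b => (b, b, b)
  | .Sp b => (b, !b, b)
  | .Cc b => (b, !b, b)
  | .M t m => (t, m, !t)

def neg (c : Col) : Col := (!c.1, !c.2.1, !c.2.2)

lemma link : ∀ (s : St) (c : Col), s ≠ .dead →
    (del s c ≠ .dead ∧ ph1 (del s c) = stp (ph1 s) (last s) c ∧
      ph2 (del s c) = stp (ph2 s) (neg (last s)) (neg c) ∧ last (del s c) = c) ∨
    (del s c = .dead ∧ (stp (ph1 s) (last s) c = .X ∨
      stp (ph2 s) (neg (last s)) (neg c) = .X)) := by
  decide

def run (f : ℕ → Col) (s : St) : ℕ → St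
  | 0 => s
  | k + 1 => del (run f s k) (f k)

lemma run_succ (f : ℕ → Col) (s : St) (k : ℕ) :
    run f s (k + 1) = run (fun j => f (j + 1)) (del s (f 0)) k := by
  induction k with
  | zero => rfl
  | succ k ih => rw [run, ih]; rfl

lemma run_link (S S' : ℕ → Fin 3 → Bool) (hS : ∀ j i, S' j i = !S j i) (k : ℕ) :
    (run (pcol S) .start k = .dead ∧ (ph S k = .X ∨ ph S' k = .X)) ∨
    (run (pcol S) .start k ≠ .dead ∧ ph S k = ph1 (run (pcol S) .start k) ∧
      ph S' k = ph2 (run (pcol S) .start k) ∧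
      (run (pcol S) .start k = .start ∨ last (run (pcol S) .start k) = pcol S (k - 1))) := by
  have hneg : ∀ j, pcol S' j = neg (pcol S j) := by
    intro j; simp [pcol, neg, hS]
  induction k with
  | zero => right; exact ⟨by simp [run], rfl, rfl, Or.inl rfl⟩
  | succ k ih =>
    rw [run, ph, ph, Nat.add_sub_cancel, hneg, hneg]
    generalize run (pcol S) .start k = s at ih ⊢
    rcases ih with ⟨h, h'⟩ | ⟨h1, h2, h3, h4⟩
    · left
      rw [h]
      refine ⟨rfl, ?_⟩
      rcases h' with h' | h' <;> rw [h']
      · left; rfl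
      · right; rfl
    · rw [h2, h3]
      have e1 : stp (ph1 s) (pcol S (k - 1)) (pcol S k) = stp (ph1 s) (last s) (pcol S k) := by
        rcases h4 with h4 | h4
        · rw [h4]; rfl
        · rw [h4]
      have e2 : stp (ph2 s) (neg (pcol S (k - 1))) (neg (pcol S k)) =
          stp (ph2 s) (neg (last s)) (neg (pcol S k)) := by
        rcases h4 with h4 | h4
        · rw [h4]; rfl
        · rw [h4]
      rw [e1, e2]
      rcases link s (pcol S k) h1 with ⟨a, b, c, d⟩ | h
      · right; exact ⟨a, b.symm, c.symm, Or.inr d⟩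
      · left; exact h

lemma acc_ph : ∀ s, s ≠ .dead → (acc s = true ↔ (ph1 s = .C ∨ ph1 s = .F) ∧
    (ph2 s = .C ∨ ph2 s = .F)) := by decide

lemma acc_iff (S S' : ℕ → Fin 3 → Bool) (hS : ∀ j i, S' j i = !S j i) (k : ℕ) :
    acc (run (pcol S) .start k) = true ↔
      (Full S k ∧ ∃ p, In S k p) ∧ (Full S' k ∧ ∃ p, In S' k p) := by
  rw [ph_iff, ph_iff]
  rcases run_link S S' hS k with ⟨h, h'⟩ | ⟨h1, h2, h3, -⟩
  · rw [h]
    rcases h' with h' | h' <;> rw [h'] <;> simp [acc]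
  · rw [h2, h3]; exact acc_ph _ h1

/-! ### The graph bridge -/

lemma grid_adj {N : ℕ} (a b : Fin 3 × Fin N) :
    (gridGraph 3 N).Adj a b ↔ adj (a.1, (a.2 : ℕ)) (b.1, (b.2 : ℕ)) := by
  obtain ⟨a1, a2⟩ := a
  obtain ⟨b1, b2⟩ := b
  simp only [gridGraph, SimpleGraph.fromRel_adj, adj, ne_eq, Prod.mk.injEq, Fin.ext_iff]
  omega

lemma conn_iff {N : ℕ} (T : Finset (Fin 3 × Fin N)) (S : ℕ → Fin 3 → Bool)
    (h : ∀ i (j : Fin N), S j i = true ↔ (i, j) ∈ T) :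
    ConnectedRegion 3 N T ↔ (Full S N ∧ ∃ p, In S N p) := by
  unfold ConnectedRegion
  rw [SimpleGraph.connected_iff]
  constructor
  · rintro ⟨hp, ⟨⟨⟨i, j⟩, hij⟩⟩⟩
    refine ⟨?_, (i, j), j.2, (h i j).2 hij⟩
    rintro ⟨i, j⟩ ⟨i', j'⟩ ⟨h1, h2⟩ ⟨h3, h4⟩
    simp only at h1 h2 h3 h4
    have := hp ⟨(i, ⟨j, h1⟩), (h i ⟨j, h1⟩).1 h2⟩ ⟨(i', ⟨j', h3⟩), (h i' ⟨j', h3⟩).1 h4⟩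
    rw [SimpleGraph.reachable_iff_reflTransGen] at this
    have key : ∀ a b : (T : Set (Fin 3 × Fin N)),
        Relation.ReflTransGen (((gridGraph 3 N).induce (T : Set (Fin 3 × Fin N))).Adj) a b →
        R S N (a.1.1, (a.1.2 : ℕ)) (b.1.1, (b.1.2 : ℕ)) := by
      intro a b hab
      induction hab with
      | refl => exact .refl
      | @tail b c _ h2 ih =>
        refine ih.tail ⟨(grid_adj _ _).1 h2, ⟨b.1.2.2, (h _ _).2 b.2⟩, ⟨c.1.2.2, (h _ _).2 c.2⟩⟩
    exact key _ _ this
  · rintro ⟨hF, ⟨i, j⟩, h1, h2⟩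
    refine ⟨?_, ⟨⟨(i, ⟨j, h1⟩), (h i ⟨j, h1⟩).1 h2⟩⟩⟩
    rintro ⟨⟨a1, a2⟩, ha⟩ ⟨⟨b1, b2⟩, hb⟩
    rw [SimpleGraph.reachable_iff_reflTransGen]
    have key : ∀ p q : Cell, R S N p q → ∀ (hp : In S N p), ∃ hq : In S N q,
        Relation.ReflTransGen (((gridGraph 3 N).induce (T : Set (Fin 3 × Fin N))).Adj)
          ⟨(p.1, ⟨p.2, hp.1⟩), (h _ ⟨p.2, hp.1⟩).1 hp.2⟩
          ⟨(q.1, ⟨q.2, hq.1⟩), (h _ ⟨q.2, hq.1⟩).1 hq.2⟩ := by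
      intro p q hpq hp
      unfold R at hpq
      induction hpq with
      | refl => exact ⟨hp, .refl⟩
      | tail _ h2 ih =>
        obtain ⟨hq, ih⟩ := ih
        exact ⟨h2.2.2, ih.tail ((grid_adj _ _).2 h2.1)⟩
    have ia : In S N (a1, (a2 : ℕ)) := ⟨a2.2, (h _ _).2 ha⟩
    have ib : In S N (b1, (b2 : ℕ)) := ⟨b2.2, (h _ _).2 hb⟩
    obtain ⟨_, hk⟩ := key _ _ (hF _ _ ia ib) ia
    exact hk

/-! ### Counting -/

def sel (c : Col) (i : Fin 3) : Bool := ![c.1, c.2.1, c.2.2] i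

lemma wt_sel : ∀ c : Col, wt c = 2 * (∑ i : Fin 3, if sel c i = true then (1 : ℤ) else 0) - 3 := by
  decide

def ext {N : ℕ} (w : Fin N → Col) (j : ℕ) : Col :=
  if h : j < N then w ⟨j, h⟩ else (false, false, false)

lemma g_count (N : ℕ) : ∀ (s : St) (d : ℤ), g N s d =
    (Finset.univ.filter (fun w : Fin N → Col =>
      acc (run (ext w) s N) = true ∧ d + ∑ j, wt (w j) = 0)).card := by
  induction N with
  | zero =>
    intro s d
    simp only [g, run, Finset.univ_eq_empty, Finset.sum_empty, add_zero]
    split_ifs with h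
    · rw [Finset.filter_true_of_mem (fun _ _ => h)]; simp
    · rw [Finset.filter_false_of_mem (fun _ _ => h)]; simp
  | succ N ih =>
    intro s d
    rw [g]
    simp only [ih, Finset.card_filter]
    rw [← Fintype.sum_prod_type']
    refine Fintype.sum_equiv (Fin.consEquiv (fun _ : Fin (N + 1) => Col)) _ _ ?_
    rintro ⟨c, w⟩
    have e1 : (fun j => ext (Fin.cons c w : Fin (N + 1) → Col) (j + 1)) = ext w := by
      funext j
      unfold ext
      by_cases h : j < N
      · rw [dif_pos h, dif_pos (by omega)]
        exact Fin.cons_succ (α := fun _ => Col) c w ⟨j, h⟩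
      · rw [dif_neg h, dif_neg (by omega)]
    have e2 : ext (Fin.cons c w : Fin (N + 1) → Col) 0 = c := by
      unfold ext
      rw [dif_pos (by omega)]
      rfl
    change _ = if acc (run (ext (Fin.cons c w : Fin (N + 1) → Col)) s (N + 1)) = true ∧
      d + ∑ j, wt ((Fin.cons c w : Fin (N + 1) → Col) j) = 0 then 1 else 0
    rw [run_succ, e1, e2, Fin.sum_univ_succ]
    simp only [Fin.cons_zero, Fin.cons_succ, add_assoc]

def toT {N : ℕ} : (Fin N → Col) ≃ Finset (Fin 3 × Fin N) where
  toFun w := Finset.univ.filter (fun p => sel (w p.2) p.1 = true)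
  invFun T j := (decide ((0, j) ∈ T), decide ((1, j) ∈ T), decide ((2, j) ∈ T))
  left_inv w := by
    funext j
    refine Prod.ext ?_ (Prod.ext ?_ ?_) <;>
      exact Bool.eq_iff_iff.2 (by
        simp only [Finset.mem_filter, Finset.mem_univ, true_and, decide_eq_true_iff]
        simp [sel])
  right_inv T := by
    ext ⟨i, j⟩
    rcases fin3 i with rfl | rfl | rfl <;>
      simp only [Finset.mem_filter, Finset.mem_univ, true_and] <;> simp [sel]

lemma toT_card {N : ℕ} (w : Fin N → Col) : ∑ j, wt (w j) = 2 * ((toT w).card : ℤ) - 3 * N := by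
  simp only [wt_sel, Finset.sum_sub_distrib, ← Finset.mul_sum]
  simp only [toT, Equiv.coe_fn_mk, Finset.card_filter]
  rw [Fintype.sum_prod_type_right]
  push_cast
  simp
  ring

lemma card_eq (n : ℕ) : Nat.card {S : Finset (Fin 3 × Fin (2 * n)) //
        S.card = 3 * n ∧ ConnectedRegion 3 (2 * n) S ∧ ConnectedRegion 3 (2 * n) Sᶜ} =
      g (2 * n) .start 0 := by
  rw [g_count, ← Fintype.card_subtype, ← Nat.card_eq_fintype_card]
  refine (Nat.card_congr (Equiv.subtypeEquiv toT ?_)).symm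
  intro w
  have hc := toT_card w
  have hp : pcol (fun j i => sel (ext w j) i) = ext w := by
    funext j; simp [pcol, sel]
  have hacc := acc_iff (fun j i => sel (ext w j) i) (fun j i => !sel (ext w j) i)
    (fun _ _ => rfl) (2 * n)
  rw [hp] at hacc
  have h1 : ∀ i (j : Fin (2 * n)), sel (ext w j) i = true ↔ (i, j) ∈ toT w := by
    intro i j
    simp [toT, ext]
  rw [hacc, conn_iff (toT w) (fun j i => sel (ext w j) i) h1,
    conn_iff (toT w)ᶜ (fun j i => !sel (ext w j) i)
      (by intro i j; rw [Finset.mem_compl, ← h1]; simp), hc]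
  push_cast
  constructor
  · rintro ⟨a, b⟩; exact ⟨by omega, a⟩
  · rintro ⟨a, b⟩; exact ⟨b, by rw [a]; push_cast; ring⟩

lemma g_odd (k : ℕ) : ∀ (s : St) (d : ℤ), Odd ((k : ℤ) + d) → g k s d = 0 := by
  induction k with
  | zero =>
    intro s d h
    simp only [g]
    rw [if_neg]
    rintro ⟨-, rfl⟩
    simp at h
  | succ k ih =>
    intro s d h
    rw [g]
    refine Finset.sum_eq_zero fun c _ => ih _ _ ?_
    have : ∀ c : Col, Odd (wt c) := by
      intro c; rw [wt_sel]; exact ⟨(∑ i : Fin 3, if sel c i = true then (1 : ℤ) else 0) - 2, by ring⟩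
    obtain ⟨u, hu⟩ := this c
    obtain ⟨v, hv⟩ := h
    push_cast at hv
    exact ⟨u + v - 0, by omega⟩

end Gerry

/-- Let `a 0 = 1` and, for `n ≥ 1`, let `a n` be half the number of subsets `S` of
the `3 × 2n` board with `|S| = 3n` such that both `S` and its complement are
connected. Then for every real `x` with `|x| < 1/64` the series `∑ aₙ xⁿ`
converges, with sum
`(1 + √(1−4x)) / ((√(1−4x) + x)² · √(1−4x)) − (1 − x² + 2x³)/(1−x)³`. -/
theorem gerrymander_3xn_genfun (a : ℕ → ℕ) (ha0 : a 0 = 1)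
    (ha : ∀ n : ℕ, 1 ≤ n →
      2 * a n = Nat.card {S : Finset (Fin 3 × Fin (2 * n)) //
        S.card = 3 * n ∧ ConnectedRegion 3 (2 * n) S ∧ ConnectedRegion 3 (2 * n) Sᶜ})
    (x : ℝ) (hx : |x| < 1 / 64) :
    HasSum (fun n : ℕ => (a n : ℝ) * x ^ n)
      ((1 + Real.sqrt (1 - 4 * x)) /
          ((Real.sqrt (1 - 4 * x) + x) ^ 2 * Real.sqrt (1 - 4 * x))
        - (1 - x ^ 2 + 2 * x ^ 3) / (1 - x) ^ 3) := by
  obtain ⟨p, hz2, hz8, hval⟩ := Gerry.exists_par x hx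
  have H := p.hasSum_g hz8
  rw [hval] at H
  have hinj : Function.Injective (fun n : ℕ => 2 * n) := fun m n h => by
    simp only at h; omega
  have H2 := (hinj.hasSum_iff (f := fun k => (Gerry.g k .start 0 : ℂ) * p.z ^ k) (by
    intro k hk
    have hodd : Odd k := by
      rw [← Nat.not_even_iff_odd]
      rintro ⟨m, hm⟩
      exact hk ⟨m, by simp only; omega⟩
    rw [Gerry.g_odd k .start 0 (by simpa using hodd)]
    simp)).2 H
  have hg0 : Gerry.g 0 .start 0 = 0 := by simp [Gerry.g, Gerry.acc]
  have e : ∀ n : ℕ, (Gerry.g (2 * n) .start 0 : ℂ) * p.z ^ (2 * n) =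
      ((((2 : ℝ) * ((a n : ℝ) * x ^ n - if n = 0 then 1 else 0) : ℝ)) : ℂ) := by
    intro n
    rw [pow_mul, hz2]
    rcases Nat.eq_zero_or_pos n with rfl | hn
    · rw [Nat.mul_zero, hg0, ha0]; simp
    · rw [← Gerry.card_eq, ← ha n hn, if_neg (by omega)]
      push_cast
      ring
  have H3 : HasSum (fun n : ℕ => ((((2 : ℝ) * ((a n : ℝ) * x ^ n - if n = 0 then 1 else 0) : ℝ)) : ℂ))
      (((2 * ((((1 + Real.sqrt (1 - 4 * x)) /
          ((Real.sqrt (1 - 4 * x) + x) ^ 2 * Real.sqrt (1 - 4 * x))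
        - (1 - x ^ 2 + 2 * x ^ 3) / (1 - x) ^ 3 : ℝ)) - 1) : ℝ)) : ℂ) := by
    convert H2 using 1
    · funext n; exact (e n).symm
    · push_cast; rfl
  have H4 := Complex.hasSum_ofReal.1 H3
  have H5 : HasSum (fun n : ℕ => if n = 0 then (1 : ℝ) else 0) 1 := by
    simpa using hasSum_ite_eq (0 : ℕ) (1 : ℝ)
  have H6 := (H4.mul_left (1 / 2)).add H5
  have e5 : (fun n : ℕ => (a n : ℝ) * x ^ n) = fun n : ℕ =>
      1 / 2 * (2 * ((a n : ℝ) * x ^ n - if n = 0 then 1 else 0)) + if n = 0 then 1 else 0 := by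
    funext n; ring
  have e6 : ∀ t : ℝ, t = 1 / 2 * (2 * (t - 1)) + 1 := fun t => by ring
  rw [e5, e6 (_ - _)]
  exact H6
end

section
/- Fix m ≥ 1. For n ≥ 1 let p_{m,n} ∈ ℤ[x] be the polynomial p_{m,n}(x) = ∑_S x^{|S|}, the sum ranging over all subsets S of the m×n board such that both S and its complement are preconnected. Then the sequence (p_{m,n})_{n≥1} satisfies a linear recurrence with polynomial coefficients that are independent of n: there exist r ≥ 1 and polynomials c₀, …, c_{r−1} ∈ ℤ[x] such that for all n ≥ 1, p_{m,n+r} = c_{r−1}·p_{m,n+r−1} + ⋯ + c₀·p_{m,n}. -/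
/-- A subset of cells is preconnected if any two of its cells are joined by a
path of the grid graph staying inside it. -/
def PreconnectedRegion (m n : ℕ) (S : Finset (Fin m × Fin n)) : Prop :=
  ((gridGraph m n).induce (S : Set (Fin m × Fin n))).Preconnected

open scoped Classical in
/-- The counting polynomial `∑_S x^|S|`, over subsets `S` of the `m × n` board
such that both `S` and its complement are preconnected. -/
noncomputable def countPoly (m n : ℕ) : Polynomial ℤ :=
  ∑ S ∈ Finset.univ.filter (fun S : Finset (Fin m × Fin n) =>
      PreconnectedRegion m n S ∧ PreconnectedRegion m n Sᶜ),
    Polynomial.X ^ S.card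

namespace GridTransfer

open Relation

/-- Symmetric adjacency on the strip of height `m` (columns indexed by `ℕ`). -/
def Adj {m : ℕ} (p q : Fin m × ℕ) : Prop :=
  (p.1 = q.1 ∧ (p.2 + 1 = q.2 ∨ q.2 + 1 = p.2)) ∨
    (p.2 = q.2 ∧ ((p.1 : ℕ) + 1 = q.1 ∨ (q.1 : ℕ) + 1 = p.1))

/-- A monochromatic step in columns `≤ k`. -/
def Step {m : ℕ} (f : ℕ → Fin m → Bool) (k : ℕ) (p q : Fin m × ℕ) : Prop :=
  Adj p q ∧ p.2 ≤ k ∧ q.2 ≤ k ∧ f p.2 p.1 = f q.2 q.1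

/-- Monochromatic reachability in columns `≤ k`. -/
def Reach {m : ℕ} (f : ℕ → Fin m → Bool) (k : ℕ) : Fin m × ℕ → Fin m × ℕ → Prop :=
  ReflTransGen (Step f k)

lemma Step.symm {m : ℕ} {f : ℕ → Fin m → Bool} {k : ℕ} {p q : Fin m × ℕ}
    (h : Step f k p q) : Step f k q p := by
  obtain ⟨h1, h2, h3, h4⟩ := h
  refine ⟨?_, h3, h2, h4.symm⟩
  unfold Adj at *
  rcases h1 with ⟨a, b⟩ | ⟨a, b⟩
  · exact Or.inl ⟨a.symm, b.symm⟩
  · exact Or.inr ⟨a.symm, b.symm⟩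

lemma Reach.symm {m : ℕ} {f : ℕ → Fin m → Bool} {k : ℕ} {p q : Fin m × ℕ}
    (h : Reach f k p q) : Reach f k q p := by
  induction h with
  | refl => exact ReflTransGen.refl
  | tail _ hs ih => exact ReflTransGen.head hs.symm ih

lemma Reach.mono {m : ℕ} {f : ℕ → Fin m → Bool} {k : ℕ} {p q : Fin m × ℕ}
    (h : Reach f k p q) : Reach f (k + 1) p q :=
  ReflTransGen.mono (r := Step f k) (p := Step f (k + 1))
    (fun _ _ ⟨a, b, c, d⟩ => ⟨a, by omega, by omega, d⟩) _ _ h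

lemma Reach.local {m : ℕ} {f g : ℕ → Fin m → Bool} {k : ℕ} (hfg : ∀ i ≤ k, f i = g i) :
    Reach f k = Reach g k := by
  have : Step f k = Step g k := by
    funext p q
    apply propext
    unfold Step
    constructor
    · rintro ⟨a, b, c, d⟩
      exact ⟨a, b, c, by rw [← hfg _ b, ← hfg _ c]; exact d⟩
    · rintro ⟨a, b, c, d⟩
      exact ⟨a, b, c, by rw [hfg _ b, hfg _ c]; exact d⟩
  unfold Reach
  rw [this]

lemma Reach.eq_or {m : ℕ} {f : ℕ → Fin m → Bool} {k : ℕ} {p q : Fin m × ℕ}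
    (h : Reach f k p q) : p = q ∨ (p.2 ≤ k ∧ q.2 ≤ k) := by
  induction h with
  | refl => exact Or.inl rfl
  | tail _ hs ih =>
    rcases ih with rfl | ih
    · exact Or.inr ⟨hs.2.1, hs.2.2.1⟩
    · exact Or.inr ⟨ih.1, hs.2.2.1⟩

lemma Reach.color {m : ℕ} {f : ℕ → Fin m → Bool} {k : ℕ} {p q : Fin m × ℕ}
    (h : Reach f k p q) : f p.2 p.1 = f q.2 q.1 := by
  induction h with
  | refl => rfl
  | tail _ hs ih => exact ih.trans hs.2.2.2

/-- A path either stays in the first columns or passes through column `k`. -/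
lemma Reach.cross {m : ℕ} {f : ℕ → Fin m → Bool} {k : ℕ} {p q : Fin m × ℕ}
    (hp : p.2 ≤ k) (h : Reach f (k + 1) p q) :
    (q.2 ≤ k ∧ Reach f k p q) ∨ ∃ j, Reach f k p (j, k) := by
  induction h with
  | refl => exact Or.inl ⟨hp, ReflTransGen.refl⟩
  | @tail b c _ hs ih =>
    rcases ih with ⟨hb, ih⟩ | ih
    · by_cases hc : c.2 ≤ k
      · exact Or.inl ⟨hc, ih.tail ⟨hs.1, hb, hc, hs.2.2.2⟩⟩
      · right
        have hbk : b.2 = k := by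
          rcases hs.1 with ⟨_, h⟩ | ⟨h, _⟩ <;> omega
        refine ⟨b.1, ?_⟩
        rw [← hbk] at ih ⊢
        exact ih
    · exact Or.inr ih

/-- States of the transfer automaton. -/
abbrev Q (m : ℕ) : Type :=
  (Fin m → Bool) × (Fin m → Fin m → Prop) × (Bool → Prop) × (Bool → Prop)

/-- The state reached after reading the columns `0, …, k`. -/
def sem {m : ℕ} (f : ℕ → Fin m → Bool) (k : ℕ) : Q m :=
  (f k, fun i j => Reach f k (i, k) (j, k),
    fun c => ∀ p : Fin m × ℕ, p.2 ≤ k → f p.2 p.1 = c → ∃ j, Reach f k p (j, k),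
    fun c => ∀ p q : Fin m × ℕ, p.2 ≤ k → q.2 ≤ k → f p.2 p.1 = c → f q.2 q.1 = c →
      Reach f k p q)

lemma sem_local {m : ℕ} {f g : ℕ → Fin m → Bool} {k : ℕ} (hfg : ∀ i ≤ k, f i = g i) :
    sem f k = sem g k := by
  unfold sem
  rw [Reach.local hfg, hfg k le_rfl]
  congr 3
  · funext c
    apply propext
    refine forall_congr' fun p => forall_congr' fun hp => ?_
    rw [hfg _ hp]
  · funext c
    apply propext
    refine forall_congr' fun p => forall_congr' fun q => forall_congr' fun hp =>
      forall_congr' fun hq => ?_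
    rw [hfg _ hp, hfg _ hq]

/-- Elementary connections among the last column (`false`) and the new one (`true`). -/
def H {m : ℕ} (s : Q m) (a : Fin m → Bool) (p q : Fin m × Bool) : Prop :=
  (p.2 = false ∧ q.2 = false ∧ s.2.1 p.1 q.1) ∨
  (p.2 = true ∧ q.2 = true ∧ ((p.1 : ℕ) + 1 = q.1 ∨ (q.1 : ℕ) + 1 = p.1) ∧ a p.1 = a q.1) ∨
  (p.2 ≠ q.2 ∧ p.1 = q.1 ∧ s.1 p.1 = a p.1)

/-- Transition function. -/
def delta {m : ℕ} (s : Q m) (a : Fin m → Bool) : Q m :=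
  (a, fun i j => ReflTransGen (H s a) (i, true) (j, true),
    fun c => s.2.2.1 c ∧ ∀ i, s.1 i = c → ∃ j, ReflTransGen (H s a) (i, false) (j, true),
    fun c => (s.2.2.1 c ∧ ∀ p q : Fin m × Bool, (if p.2 then a p.1 else s.1 p.1) = c →
        (if q.2 then a q.1 else s.1 q.1) = c → ReflTransGen (H s a) p q) ∨
      (¬ s.2.2.1 c ∧ s.2.2.2 c ∧ ∀ j, a j ≠ c))

/-- Embedding of the two boundary columns. -/
def emb {m : ℕ} (k : ℕ) (p : Fin m × Bool) : Fin m × ℕ := (p.1, if p.2 then k + 1 else k)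

lemma emb_inj {m k : ℕ} {p q : Fin m × Bool} (h : emb k p = emb k q) : p = q := by
  obtain ⟨i, b⟩ := p
  obtain ⟨j, c⟩ := q
  cases b <;> cases c <;> simp_all [emb]

lemma emb_of {m k : ℕ} {p : Fin m × ℕ} (h : p.2 = k ∨ p.2 = k + 1) : ∃ b, emb k b = p := by
  obtain ⟨i, j⟩ := p
  rcases h with h | h
  · exact ⟨(i, false), by simp_all [emb]⟩
  · exact ⟨(i, true), by simp_all [emb]⟩

lemma H_sound {m : ℕ} {f : ℕ → Fin m → Bool} {k : ℕ} {p q : Fin m × Bool}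
    (h : ReflTransGen (H (sem f k) (f (k + 1))) p q) : Reach f (k + 1) (emb k p) (emb k q) := by
  induction h with
  | refl => exact ReflTransGen.refl
  | @tail b c _ hs ih =>
    refine ReflTransGen.trans ih ?_
    obtain ⟨i, b⟩ := b
    obtain ⟨j, c⟩ := c
    rcases hs with ⟨h1, h2, h3⟩ | ⟨h1, h2, h3, h4⟩ | ⟨h1, h2, h3⟩
    · simp only at h1 h2
      subst h1 h2
      exact Reach.mono h3
    · simp only at h1 h2
      subst h1 h2
      exact ReflTransGen.single ⟨Or.inr ⟨rfl, h3⟩, le_rfl, le_rfl, h4⟩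
    · simp only at h1 h2
      subst h2
      change f k i = f (k + 1) i at h3
      cases b <;> cases c <;> simp at h1
      · exact ReflTransGen.single ⟨Or.inl ⟨rfl, by simp [emb]⟩, by simp [emb], by simp [emb],
          by simpa [emb] using h3⟩
      · exact ReflTransGen.single ⟨Or.inl ⟨rfl, by simp [emb]⟩, by simp [emb], by simp [emb],
          by simpa [emb] using h3.symm⟩

lemma H_of_reach {m : ℕ} {f : ℕ → Fin m → Bool} {k : ℕ} {p q : Fin m × Bool}
    (h : Reach f k (emb k p) (emb k q)) :
    ReflTransGen (H (sem f k) (f (k + 1))) p q := by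
  rcases h.eq_or with h' | h'
  · rw [emb_inj h']
  · obtain ⟨i, b⟩ := p
    obtain ⟨j, c⟩ := q
    cases b <;> cases c <;> simp [emb] at h'
    exact ReflTransGen.single (Or.inl ⟨rfl, rfl, h⟩)

lemma H_of_step {m : ℕ} {f : ℕ → Fin m → Bool} {k : ℕ} {p q : Fin m × Bool}
    (h : Step f (k + 1) (emb k p) (emb k q)) :
    ReflTransGen (H (sem f k) (f (k + 1))) p q := by
  obtain ⟨i, b⟩ := p
  obtain ⟨j, c⟩ := q
  obtain ⟨h1, h2, h3, h4⟩ := h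
  cases b <;> cases c
  · refine H_of_reach (ReflTransGen.single ⟨h1, ?_, ?_, h4⟩) <;> simp [emb]
  · refine ReflTransGen.single (Or.inr (Or.inr ?_))
    simp [emb, Adj] at h1 h4
    subst h1
    exact ⟨by simp, rfl, h4⟩
  · refine ReflTransGen.single (Or.inr (Or.inr ?_))
    simp [emb, Adj] at h1 h4
    subst h1
    exact ⟨by simp, rfl, h4.symm⟩
  · refine ReflTransGen.single (Or.inr (Or.inl ?_))
    simp [emb, Adj] at h1 h4
    exact ⟨rfl, rfl, h1, h4⟩

lemma H_complete' {m : ℕ} {f : ℕ → Fin m → Bool} {k : ℕ} {p : Fin m × Bool} {y : Fin m × ℕ}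
    (h : Reach f (k + 1) (emb k p) y) :
    ∃ b, ReflTransGen (H (sem f k) (f (k + 1))) p b ∧ Reach f k (emb k b) y := by
  induction h with
  | refl => exact ⟨p, ReflTransGen.refl, ReflTransGen.refl⟩
  | @tail y z _ hs ih =>
    obtain ⟨b, h1, h2⟩ := ih
    by_cases hyz : y.2 ≤ k ∧ z.2 ≤ k
    · exact ⟨b, h1, h2.tail ⟨hs.1, hyz.1, hyz.2, hs.2.2.2⟩⟩
    · have hb := hs.1
      have hy := hs.2.1
      have hz := hs.2.2.1
      unfold Adj at hb
      obtain ⟨y', rfl⟩ := emb_of (p := y) (k := k) (by omega)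
      obtain ⟨z', rfl⟩ := emb_of (p := z) (k := k) (by omega)
      exact ⟨z', (h1.trans (H_of_reach h2)).trans (H_of_step hs), ReflTransGen.refl⟩

lemma H_iff {m : ℕ} {f : ℕ → Fin m → Bool} {k : ℕ} {p q : Fin m × Bool} :
    ReflTransGen (H (sem f k) (f (k + 1))) p q ↔ Reach f (k + 1) (emb k p) (emb k q) := by
  refine ⟨H_sound, fun h => ?_⟩
  obtain ⟨b, h1, h2⟩ := H_complete' h
  exact h1.trans (H_of_reach h2)

lemma sem_succ {m : ℕ} (f : ℕ → Fin m → Bool) (k : ℕ) :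
    sem f (k + 1) = delta (sem f k) (f (k + 1)) := by
  unfold delta
  simp only [H_iff]
  refine Prod.ext rfl (Prod.ext rfl (Prod.ext ?_ ?_))
  · funext c
    apply propext
    constructor
    · intro h
      refine ⟨fun p hp hc => ?_, fun i hi => ?_⟩
      · obtain ⟨j, hj⟩ := h p (by omega) hc
        rcases hj.cross hp with h' | h'
        · simp at h'
        · exact h'
      · exact h (i, k) (by simp) hi
    · rintro ⟨h1, h2⟩ p hp hc
      rcases Nat.lt_or_ge k p.2 with h | h
      · have hpk : p.2 = k + 1 := by omega
        refine ⟨p.1, ?_⟩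
        rw [← hpk]
        exact ReflTransGen.refl
      · obtain ⟨j, hj⟩ := h1 p h hc
        obtain ⟨j', hj'⟩ := h2 j (hj.color.symm.trans hc)
        exact ⟨j', ReflTransGen.trans hj.mono hj'⟩
  · funext c
    apply propext
    have hcol : ∀ p : Fin m × Bool, (if p.2 then f (k + 1) p.1 else f k p.1) =
        f (emb k p).2 (emb k p).1 := by
      rintro ⟨i, b⟩
      cases b <;> rfl
    by_cases hF : (sem f k).2.2.1 c
    · constructor
      · intro h
        refine Or.inl ⟨hF, fun p q hp hq => ?_⟩
        refine h _ _ ?_ ?_ ((hcol p).symm.trans hp) ((hcol q).symm.trans hq)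
        · simp only [emb]; split <;> omega
        · simp only [emb]; split <;> omega
      · rintro (⟨-, h⟩ | ⟨h, -⟩)
        · have key : ∀ p : Fin m × ℕ, p.2 ≤ k + 1 → f p.2 p.1 = c →
              ∃ b, Reach f (k + 1) p (emb k b) := by
            intro p hp hc
            rcases Nat.lt_or_ge k p.2 with h | h
            · obtain ⟨b, rfl⟩ := emb_of (p := p) (k := k) (by omega)
              exact ⟨b, ReflTransGen.refl⟩
            · obtain ⟨j, hj⟩ := hF p h hc
              exact ⟨(j, false), hj.mono⟩
          intro p q hp hq hcp hcq
          obtain ⟨b, hb⟩ := key p hp hcp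
          obtain ⟨b', hb'⟩ := key q hq hcq
          refine ReflTransGen.trans hb (ReflTransGen.trans (h b b' ?_ ?_) hb'.symm)
          · exact (hcol b).trans (hb.color.symm.trans hcp)
          · exact (hcol b').trans (hb'.color.symm.trans hcq)
        · exact absurd hF h
    · have hF' := hF
      change ¬ (∀ p : Fin m × ℕ, p.2 ≤ k → f p.2 p.1 = c → ∃ j, Reach f k p (j, k)) at hF'
      push Not at hF'
      obtain ⟨p, hp, hpc, hpn⟩ := hF'
      constructor
      · intro h
        refine Or.inr ⟨hF, fun q r hq hr hqc hrc => ?_, fun j hj => ?_⟩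
        · rcases (h q r (by omega) (by omega) hqc hrc).cross hq with h' | ⟨j, hj⟩
          · exact h'.2
          · rcases (h p q (by omega) (by omega) hpc hqc).cross hp with h' | ⟨j', hj'⟩
            · exact absurd (ReflTransGen.trans h'.2 hj) (hpn j)
            · exact absurd hj' (hpn j')
        · rcases (h p (j, k + 1) (by omega) le_rfl hpc hj).cross hp with h' | ⟨j', hj'⟩
          · simp at h'
          · exact absurd hj' (hpn j')
      · rintro (⟨h, -⟩ | ⟨-, h1, h2⟩)
        · exact absurd h hF
        · have key : ∀ p : Fin m × ℕ, p.2 ≤ k + 1 → f p.2 p.1 = c → p.2 ≤ k := by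
            intro p hp hc
            by_contra hn
            have hpk : p.2 = k + 1 := by omega
            rw [hpk] at hc
            exact h2 _ hc
          intro q r hq hr hqc hrc
          exact Reach.mono (h1 q r (key q hq hqc) (key r hr hrc) hqc hrc)

lemma preconn_iff {m k : ℕ} (f : ℕ → Fin m → Bool) (c : Bool) (S : Finset (Fin m × Fin (k + 1)))
    (hS : ∀ p : Fin m × Fin (k + 1), p ∈ S ↔ f p.2 p.1 = c) :
    PreconnectedRegion m (k + 1) S ↔ (sem f k).2.2.2 c := by
  constructor
  · rintro h ⟨pi, pj⟩ ⟨qi, qj⟩ hp hq hpc hqc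
    simp only at hp hq hpc hqc
    have hr := h ⟨(pi, ⟨pj, by omega⟩), (hS _).2 hpc⟩ ⟨(qi, ⟨qj, by omega⟩), (hS _).2 hqc⟩
    rw [SimpleGraph.reachable_iff_reflTransGen] at hr
    refine ReflTransGen.lift (fun x : (S : Set (Fin m × Fin (k + 1))) => ((x.1.1, (x.1.2 : ℕ)) : Fin m × ℕ)) ?_ _ _ hr
    rintro ⟨x, hx⟩ ⟨y, hy⟩ hxy
    have hx' := (hS x).1 hx
    have hy' := (hS y).1 hy
    refine ⟨?_, Nat.lt_succ_iff.1 x.2.2, Nat.lt_succ_iff.1 y.2.2, hx'.trans hy'.symm⟩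
    simp only [SimpleGraph.comap_adj, gridGraph, SimpleGraph.fromRel_adj,
      Function.Embedding.subtype_apply] at hxy
    unfold Adj
    simp only [Fin.ext_iff] at hxy ⊢
    omega
  · rintro h ⟨⟨pi, pj⟩, hp⟩ ⟨⟨qi, qj⟩, hq⟩
    have hp' := (hS _).1 hp
    have hq' := (hS _).1 hq
    have hr : Reach f k (pi, (pj : ℕ)) (qi, (qj : ℕ)) :=
      h _ _ (Nat.lt_succ_iff.1 pj.2) (Nat.lt_succ_iff.1 qj.2) hp' hq'
    have key : ∀ y : Fin m × ℕ, Reach f k (pi, (pj : ℕ)) y →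
        ∀ (hy : y.2 < k + 1) (hyS : (y.1, (⟨y.2, hy⟩ : Fin (k + 1))) ∈ S),
        ((gridGraph m (k + 1)).induce (S : Set (Fin m × Fin (k + 1)))).Reachable
          ⟨(pi, pj), hp⟩ ⟨(y.1, ⟨y.2, hy⟩), hyS⟩ := by
      intro y hy
      induction hy with
      | refl => intro _ _; exact SimpleGraph.Reachable.refl _
      | @tail y z _ hs ih =>
        intro hz hzS
        have hzc := (hS _).1 hzS
        have hyk : y.2 < k + 1 := Nat.lt_succ_iff.2 hs.2.1
        have hyS : (y.1, (⟨y.2, hyk⟩ : Fin (k + 1))) ∈ S := (hS _).2 (hs.2.2.2.trans hzc)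
        refine (ih hyk hyS).trans (SimpleGraph.Adj.reachable ?_)
        have hadj := hs.1
        unfold Adj at hadj
        simp only [SimpleGraph.comap_adj, gridGraph, SimpleGraph.fromRel_adj,
          Function.Embedding.subtype_apply]
        simp only [Fin.ext_iff, ne_eq, Prod.ext_iff] at hadj ⊢
        omega
    exact key _ hr qj.2 hq

/-- Extend a finite word of columns to all of `ℕ`. -/
def ext {m k : ℕ} (w : Fin (k + 1) → Fin m → Bool) : ℕ → Fin m → Bool :=
  fun j => if h : j < k + 1 then w ⟨j, h⟩ else fun _ => false

/-- Number of `true` cells in a column. -/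
def wt {m : ℕ} (a : Fin m → Bool) : ℕ := ∑ i, if a i = true then 1 else 0

open Polynomial

/-- Weighted sum over all words with `k+1` columns. -/
noncomputable def W {m : ℕ} (k : ℕ) (g : Q m → ℤ[X]) : ℤ[X] :=
  ∑ w : Fin (k + 1) → Fin m → Bool, X ^ (∑ j, wt (w j)) * g (sem (ext w) k)

/-- Transfer operator. -/
noncomputable def Phi (m : ℕ) : Module.End ℤ[X] (Q m → ℤ[X]) where
  toFun g s := ∑ a : Fin m → Bool, X ^ wt a * g (delta s a)
  map_add' g h := by
    funext s
    simp [mul_add, Finset.sum_add_distrib]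
  map_smul' c g := by
    funext s
    simp only [Pi.smul_apply, smul_eq_mul, RingHom.id_apply, Finset.mul_sum]
    exact Finset.sum_congr rfl fun a _ => by ring

lemma W_succ {m : ℕ} (k : ℕ) (g : Q m → ℤ[X]) : W (k + 1) g = W k (Phi m g) := by
  unfold W
  rw [← (Fin.snocEquiv (fun _ : Fin (k + 1 + 1) => Fin m → Bool)).sum_comp,
    Fintype.sum_prod_type, Finset.sum_comm]
  refine Finset.sum_congr rfl fun w _ => ?_
  simp only [Phi, LinearMap.coe_mk, AddHom.coe_mk, Finset.mul_sum]
  refine Finset.sum_congr rfl fun a _ => ?_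
  have e1 : sem (ext (Fin.snoc (α := fun _ : Fin (k + 1 + 1) => Fin m → Bool) w a)) (k + 1) =
      delta (sem (ext w) k) a := by
    rw [sem_succ]
    congr 1
    · apply sem_local
      intro i hi
      have h1 : i < k + 1 + 1 := by omega
      have h2 : i < k + 1 := by omega
      simp [ext, h1, h2, Fin.snoc]
    · simp [ext, Fin.snoc]
  have e2 : ∑ j, wt ((Fin.snoc (α := fun _ : Fin (k + 1 + 1) => Fin m → Bool) w a) j) =
      (∑ j, wt (w j)) + wt a := by
    rw [Fin.sum_univ_castSucc]
    simp
  simp only [Fin.snocEquiv, Equiv.coe_fn_mk]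
  rw [e1, e2, pow_add, mul_assoc]

lemma W_pow {m : ℕ} (k : ℕ) (g : Q m → ℤ[X]) : W k g = W 0 ((Phi m ^ k) g) := by
  induction k generalizing g with
  | zero => simp
  | succ k ih => rw [W_succ, ih, pow_succ]; rfl

open scoped Classical in
/-- Acceptance. -/
noncomputable def acc (m : ℕ) (s : Q m) : ℤ[X] := if s.2.2.2 true ∧ s.2.2.2 false then 1 else 0

/-- Words are subsets of the board. -/
def wordEquiv (m n : ℕ) : Finset (Fin m × Fin n) ≃ (Fin n → Fin m → Bool) where
  toFun S j i := decide ((i, j) ∈ S)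
  invFun w := Finset.univ.filter fun p => w p.2 p.1 = true
  left_inv S := by ext p; simp
  right_inv w := by funext j i; simp

lemma countPoly_eq (m k : ℕ) : countPoly m (k + 1) = W k (acc m) := by
  classical
  unfold W countPoly
  rw [← (wordEquiv m (k + 1)).sum_comp, Finset.sum_filter]
  refine Finset.sum_congr rfl fun S _ => ?_
  have h1 : PreconnectedRegion m (k + 1) S ↔
      (sem (ext (wordEquiv m (k + 1) S)) k).2.2.2 true := by
    apply preconn_iff
    rintro ⟨i, j⟩
    have hj : (j : ℕ) ≤ k := Nat.lt_succ_iff.1 j.2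
    simp [ext, wordEquiv, hj]
  have h2 : PreconnectedRegion m (k + 1) Sᶜ ↔
      (sem (ext (wordEquiv m (k + 1) S)) k).2.2.2 false := by
    apply preconn_iff
    rintro ⟨i, j⟩
    have hj : (j : ℕ) ≤ k := Nat.lt_succ_iff.1 j.2
    simp [ext, wordEquiv, hj]
  have h3 : ∑ j, wt (wordEquiv m (k + 1) S j) = S.card := by
    simp only [wt, wordEquiv, Equiv.coe_fn_mk, decide_eq_true_eq]
    rw [Finset.sum_comm, ← Fintype.sum_prod_type' (fun i j => if (i, j) ∈ S then 1 else 0)]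
    simp
  rw [h3, acc, h1, h2]
  split_ifs <;> simp

/-- `W 0` as a linear functional. -/
noncomputable def W0 (m : ℕ) : (Q m → ℤ[X]) →ₗ[ℤ[X]] ℤ[X] where
  toFun g := W 0 g
  map_add' g h := by simp [W, mul_add, Finset.sum_add_distrib]
  map_smul' c g := by
    simp only [W, Pi.smul_apply, smul_eq_mul, RingHom.id_apply, Finset.mul_sum]
    exact Finset.sum_congr rfl fun a _ => by ring

lemma countPoly_W0 (m k : ℕ) : countPoly m (k + 1) = W0 m ((Phi m ^ k) (acc m)) := by
  rw [countPoly_eq, W_pow]; rfl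

end GridTransfer

/-- Fix `m ≥ 1`. The sequence of counting polynomials `p_{m,n}` (over subsets of
the `m × n` board that are preconnected with preconnected complement) satisfies a
linear recurrence with coefficients in `ℤ[x]` independent of `n`: there are
`r ≥ 1` and `c₀, …, c_{r−1} ∈ ℤ[x]` with
`p_{m,n+r} = c_{r−1}·p_{m,n+r−1} + ⋯ + c₀·p_{m,n}` for all `n ≥ 1`. -/
theorem countPoly_linear_recurrence (m : ℕ) (hm : 1 ≤ m) :
    ∃ r : ℕ, 1 ≤ r ∧ ∃ c : ℕ → Polynomial ℤ,
      ∀ n : ℕ, 1 ≤ n →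
        countPoly m (n + r) = ∑ i ∈ Finset.range r, c i * countPoly m (n + i) := by
  obtain ⟨p₀, hp₀, hp₀'⟩ := LinearMap.exists_monic_and_aeval_eq_zero (Polynomial ℤ)
    (GridTransfer.Phi m)
  obtain ⟨p, hp, hpz, hdeg⟩ : ∃ p : Polynomial (Polynomial ℤ), p.Monic ∧
      Polynomial.aeval (GridTransfer.Phi m) p = 0 ∧ 1 ≤ p.natDegree := by
    refine ⟨p₀ * Polynomial.X, hp₀.mul Polynomial.monic_X, by simp [hp₀'], ?_⟩
    rw [hp₀.natDegree_mul Polynomial.monic_X]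
    simp
  refine ⟨p.natDegree, hdeg, fun i => - p.coeff i, fun n hn => ?_⟩
  obtain ⟨k, rfl⟩ : ∃ k, n = k + 1 := ⟨n - 1, by omega⟩
  have key : ∑ i ∈ Finset.range (p.natDegree + 1), p.coeff i * countPoly m (k + 1 + i) = 0 := by
    have h := congrArg (fun T : Module.End _ _ => GridTransfer.W0 m
      (T ((GridTransfer.Phi m ^ k) (GridTransfer.acc m)))) hpz
    simp only [Polynomial.aeval_eq_sum_range, LinearMap.sum_apply, map_sum, LinearMap.smul_apply,
      map_smul, smul_eq_mul, LinearMap.zero_apply, map_zero] at h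
    rw [← h]
    refine Finset.sum_congr rfl fun i _ => ?_
    rw [show k + 1 + i = (i + k) + 1 by omega, GridTransfer.countPoly_W0, pow_add]
    rfl
  rw [Finset.sum_range_succ, Polynomial.coeff_natDegree, hp.leadingCoeff, one_mul] at key
  simp only [neg_mul, Finset.sum_neg_distrib]
  exact eq_neg_of_add_eq_zero_right key
end
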